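/- arXiv:2012.07567 — 8 statements merged into one kernel-verified Lean document; each statement's English description precedes it below -/
import Mathlib

section
/- Let r ≥ 1 and d ≥ 2 be integers, and let N be the set of r-tuples in SO(d)^r that are not generic. Then N has measure 0 with respect to the Haar measure on the compact topological group SO(d)^r. -/
open MeasureTheory

/-- The set of special orthogonal `d × d` real matrices. -/
def SOSet (d : ℕ) : Set (Matrix (Fin d) (Fin d) ℝ) :=
  {M | M.transpose * M = 1 ∧ M.det = 1}

/-- An `r`-tuple of `d × d` real matrices is *generic* if every polynomial with rational
coefficients in the `d²r` matrix entries that vanishes on it vanishes on all of `SO(d)^r`. -/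
def IsGeneric {d r : ℕ} (γ : Fin r → Matrix (Fin d) (Fin d) ℝ) : Prop :=
  ∀ p : MvPolynomial (Fin r × Fin d × Fin d) ℚ,
    MvPolynomial.aeval (fun q => γ q.1 q.2.1 q.2.2) p = 0 →
    ∀ β : Fin r → Matrix (Fin d) (Fin d) ℝ, (∀ s, β s ∈ SOSet d) →
      MvPolynomial.aeval (fun q => β q.1 q.2.1 q.2.2) p = 0

/-- The Borel σ-algebra on matrices (as the product σ-algebra on `m → n → α`). -/
instance {m n α : Type*} [MeasurableSpace α] : MeasurableSpace (Matrix m n α) :=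
  inferInstanceAs (MeasurableSpace (m → n → α))

open Filter Topology

/-- The matrix of the orthogonal reflection that sends `v` to `-v`; it is `1` when `v = 0`. -/
noncomputable def householder {d : ℕ} (v : Fin d → ℝ) : Matrix (Fin d) (Fin d) ℝ :=
  1 - (2 / (v ⬝ᵥ v)) • Matrix.vecMulVec v v

section Householder

variable {d : ℕ}

lemma householder_zero : householder (0 : Fin d → ℝ) = 1 := by
  simp [householder]

lemma householder_neg (v : Fin d → ℝ) : householder (-v) = householder v := by
  simp [householder, Matrix.neg_vecMulVec, Matrix.vecMulVec_neg]

lemma householder_transpose (v : Fin d → ℝ) : (householder v).transpose = householder v := by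
  simp [householder, Matrix.transpose_vecMulVec]

lemma householder_mul_self (v : Fin d → ℝ) : householder v * householder v = 1 := by
  rcases eq_or_ne v 0 with rfl | hv
  · simp [householder_zero]
  have h : v ⬝ᵥ v ≠ 0 := by simpa using hv
  have h2 : Matrix.vecMulVec v v * Matrix.vecMulVec v v = (v ⬝ᵥ v) • Matrix.vecMulVec v v := by
    simp [Matrix.vecMulVec_mul_vecMulVec]
  simp only [householder, sub_mul, mul_sub, one_mul, mul_one, smul_mul_assoc, mul_smul_comm, h2,
    smul_smul, div_mul_cancel₀ _ h]
  module

lemma householder_det {v : Fin d → ℝ} (hv : v ≠ 0) : (householder v).det = -1 := by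
  have h : v ⬝ᵥ v ≠ 0 := by simpa using hv
  have h2 : householder v = 1 + Matrix.replicateCol Unit ((-(2 / (v ⬝ᵥ v))) • v) *
      Matrix.replicateRow Unit v := by
    rw [householder, sub_eq_add_neg]
    ext i j
    simp [Matrix.mul_apply, Matrix.vecMulVec_apply, mul_assoc]
  rw [h2, Matrix.det_one_add_replicateCol_mul_replicateRow]
  simp only [dotProduct_smul, smul_eq_mul]
  field_simp
  norm_num

lemma toEuclideanLin_householder (v : Fin d → ℝ) (x : EuclideanSpace ℝ (Fin d)) :
    (householder v).toEuclideanLin x = (ℝ ∙ WithLp.toLp 2 v)ᗮ.reflection x := by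
  have hn : ‖WithLp.toLp 2 v‖ ^ 2 = v ⬝ᵥ v := by
    rw [EuclideanSpace.real_norm_sq_eq]
    simp [dotProduct, sq]
  have hi : inner ℝ (WithLp.toLp 2 v) x = v ⬝ᵥ x.ofLp := by
    simp [EuclideanSpace.inner_eq_star_dotProduct, dotProduct_comm]
  rw [Submodule.reflection_orthogonal_apply, Submodule.reflection_singleton_apply,
    RCLike.ofReal_real_eq_id, id, hn, hi]
  ext i
  simp [householder, Matrix.toLpLin_apply, Matrix.vecMulVec_mulVec]
  ring

lemma exists_eq_prod_householder {M : Matrix (Fin d) (Fin d) ℝ} (hM : M.transpose * M = 1) :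
    ∃ l : List (Fin d → ℝ), M = (l.map householder).prod := by
  have hiso : ∀ x, ‖M.toEuclideanLin x‖ = ‖x‖ := by
    intro x
    rw [EuclideanSpace.norm_eq, EuclideanSpace.norm_eq]
    have h : (M.mulVec x.ofLp) ⬝ᵥ (M.mulVec x.ofLp) = x.ofLp ⬝ᵥ x.ofLp := by
      rw [Matrix.dotProduct_mulVec, Matrix.vecMul_mulVec, hM, Matrix.vecMul_one]
    simpa [dotProduct, ← sq] using congrArg Real.sqrt h
  obtain ⟨l, -, hl⟩ := LinearIsometryEquiv.reflections_generate_dim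
    (LinearIsometry.toLinearIsometryEquiv ⟨M.toEuclideanLin, hiso⟩ rfl)
  have key : ∀ (l : List (EuclideanSpace ℝ (Fin d))) x,
      Matrix.toEuclideanLin ((l.map WithLp.ofLp).map householder).prod x =
        (l.map fun v => (ℝ ∙ v)ᗮ.reflection).prod x := by
    intro l
    induction l with
    | nil => simp
    | cons v l ih =>
      intro x
      simp [← ih, toEuclideanLin_householder]
  refine ⟨l.map WithLp.ofLp, Matrix.toEuclideanLin.injective (LinearMap.ext fun x => ?_)⟩
  rw [key, ← hl]
  rfl

end Householder

section SOSet

variable {d r : ℕ}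

lemma one_mem_SOSet : (1 : Matrix (Fin d) (Fin d) ℝ) ∈ SOSet d := by
  simp [SOSet]

lemma mul_mem_SOSet {M N : Matrix (Fin d) (Fin d) ℝ} (hM : M ∈ SOSet d) (hN : N ∈ SOSet d) :
    M * N ∈ SOSet d := by
  refine ⟨?_, by simp [hM.2, hN.2]⟩
  rw [Matrix.transpose_mul, Matrix.mul_assoc, ← Matrix.mul_assoc M.transpose, hM.1,
    Matrix.one_mul, hN.1]

lemma transpose_mem_SOSet {M : Matrix (Fin d) (Fin d) ℝ} (hM : M ∈ SOSet d) :
    M.transpose ∈ SOSet d :=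
  ⟨by rw [Matrix.transpose_transpose, mul_eq_one_comm, hM.1], by simp [hM.2]⟩

lemma householder_mul_householder_mem_SOSet {u v : Fin d → ℝ} (hu : u ≠ 0) (hv : v ≠ 0) :
    householder u * householder v ∈ SOSet d := by
  refine ⟨?_, by simp [householder_det hu, householder_det hv]⟩
  rw [Matrix.transpose_mul, householder_transpose, householder_transpose, Matrix.mul_assoc,
    ← Matrix.mul_assoc (householder u), householder_mul_self, Matrix.one_mul, householder_mul_self]

/-- A submonoid that contains all products of two hyperplane reflections contains `SO(d)`. -/
lemma SOSet_subset_of_householder_mul_mem {H : Submonoid (Matrix (Fin d) (Fin d) ℝ)}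
    (hH : ∀ u v : Fin d → ℝ, u ≠ 0 → v ≠ 0 → householder u * householder v ∈ H) :
    SOSet d ⊆ H := by
  have key : ∀ l : List (Fin d → ℝ),
      ((l.map householder).prod.det = 1 → (l.map householder).prod ∈ H) ∧
      ((l.map householder).prod.det = -1 →
        ∀ u, u ≠ 0 → householder u * (l.map householder).prod ∈ H) := by
    intro l
    induction l with
    | nil => exact ⟨fun _ => by simp, fun h => by norm_num at h⟩
    | cons v l ih =>
      rcases eq_or_ne v 0 with rfl | hv
      · simpa [householder_zero] using ih
      simp only [List.map_cons, List.prod_cons, Matrix.det_mul, householder_det hv]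
      refine ⟨fun h => ih.2 (by linarith) v hv, fun h u hu => ?_⟩
      rw [← mul_assoc]
      exact H.mul_mem (hH u v hu hv) (ih.1 (by linarith))
  intro M hM
  obtain ⟨l, rfl⟩ := exists_eq_prod_householder hM.1
  exact (key l).1 hM.2

instance {m n : Type*} [Countable m] [Countable n] : BorelSpace (Matrix m n ℝ) :=
  inferInstanceAs (BorelSpace (m → n → ℝ))

instance {m n : Type*} [Countable m] [Countable n] : SecondCountableTopology (Matrix m n ℝ) :=
  inferInstanceAs (SecondCountableTopology (m → n → ℝ))

/-- The value of `p` at the entries of a tuple of matrices. -/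
noncomputable def evalTuple (p : MvPolynomial (Fin r × Fin d × Fin d) ℚ)
    (γ : Fin r → Matrix (Fin d) (Fin d) ℝ) : ℝ :=
  MvPolynomial.aeval (fun q => γ q.1 q.2.1 q.2.2) p

lemma continuous_evalTuple (p : MvPolynomial (Fin r × Fin d × Fin d) ℚ) :
    Continuous (evalTuple p) := by
  have h : Continuous fun γ : Fin r → Matrix (Fin d) (Fin d) ℝ =>
      fun q : Fin r × Fin d × Fin d => γ q.1 q.2.1 q.2.2 := by fun_prop
  unfold evalTuple
  simp only [MvPolynomial.aeval_def, ← MvPolynomial.eval_map]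
  exact (MvPolynomial.continuous_eval _).comp h

variable {ν : Measure (Fin r → Matrix (Fin d) (Fin d) ℝ)}

lemma measure_preimage_mul_left
    (hinv : ∀ g : Fin r → Matrix (Fin d) (Fin d) ℝ, (∀ s, g s ∈ SOSet d) →
      Measure.map (fun β s => g s * β s) ν = ν)
    {g : Fin r → Matrix (Fin d) (Fin d) ℝ} (hg : ∀ s, g s ∈ SOSet d)
    {A : Set (Fin r → Matrix (Fin d) (Fin d) ℝ)} (hA : MeasurableSet A) :
    ν {γ | g * γ ∈ A} = ν A := by
  conv_rhs => rw [← hinv g hg]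
  have hc : Continuous fun β : Fin r → Matrix (Fin d) (Fin d) ℝ => fun s => g s * β s := by
    fun_prop
  rw [Measure.map_apply hc.measurable hA]
  rfl

lemma measurableSet_evalTuple_eq_zero_ne_zero (p : MvPolynomial (Fin r × Fin d × Fin d) ℚ)
    (g h : Fin r → Matrix (Fin d) (Fin d) ℝ) :
    MeasurableSet {γ | evalTuple p (g * γ) = 0 ∧ evalTuple p (h * γ) ≠ 0} := by
  have hc : ∀ g : Fin r → Matrix (Fin d) (Fin d) ℝ, Continuous fun γ => evalTuple p (g * γ) :=
    fun g => (continuous_evalTuple p).comp (continuous_const.mul continuous_id)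
  exact (isClosed_eq (hc g) continuous_const).measurableSet.inter
    (isOpen_ne_fun (hc h) continuous_const).measurableSet

/-- The elements of `SO(d)^r` that preserve the zero set of `p` up to null sets. -/
def zeroSetStabilizer (p : MvPolynomial (Fin r × Fin d × Fin d) ℚ)
    (hinv : ∀ g : Fin r → Matrix (Fin d) (Fin d) ℝ, (∀ s, g s ∈ SOSet d) →
      Measure.map (fun β s => g s * β s) ν = ν) :
    Submonoid (Fin r → Matrix (Fin d) (Fin d) ℝ) where
  carrier := {g | (∀ s, g s ∈ SOSet d) ∧ ν {γ | evalTuple p γ = 0 ∧ evalTuple p (g * γ) ≠ 0} = 0}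
  one_mem' := ⟨fun _ => one_mem_SOSet, by simp⟩
  mul_mem' := by
    rintro g h ⟨hg, hg0⟩ ⟨hh, hh0⟩
    refine ⟨fun s => mul_mem_SOSet (hg s) (hh s), ?_⟩
    have hA := measurableSet_evalTuple_eq_zero_ne_zero p 1 g
    simp only [one_mul] at hA
    rw [← measure_preimage_mul_left hinv hh hA] at hg0
    refine measure_mono_null (fun γ hγ => ?_) (measure_union_null hg0 hh0)
    by_cases hz : evalTuple p (h * γ) = 0
    · exact Or.inl ⟨hz, by rw [← mul_assoc]; exact hγ.2⟩
    · exact Or.inr ⟨hγ.1, hz⟩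

/-- The endpoint of an analytic curve in `SO(d)^r` that starts at `1` preserves the zero set of `p`
up to null sets: along the curve, `p` either vanishes identically or has isolated zeros. -/
lemma endpoint_mem_zeroSetStabilizer [IsProbabilityMeasure ν]
    (p : MvPolynomial (Fin r × Fin d × Fin d) ℚ)
    (hinv : ∀ g : Fin r → Matrix (Fin d) (Fin d) ℝ, (∀ s, g s ∈ SOSet d) →
      Measure.map (fun β s => g s * β s) ν = ν)
    {c : ℝ → Fin r → Matrix (Fin d) (Fin d) ℝ} (hc0 : c 0 = 1)
    (hc : ∀ t ∈ Set.Icc (0 : ℝ) 1, ∀ s, c t s ∈ SOSet d)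
    (hana : ∀ s i j, AnalyticOnNhd ℝ (fun t => c t s i j) (Set.Icc 0 1)) :
    c 1 ∈ zeroSetStabilizer p hinv := by
  have h1 : (1 : ℝ) ∈ Set.Icc (0 : ℝ) 1 := by simp
  have h0 : (0 : ℝ) ∈ Set.Icc (0 : ℝ) 1 := by simp
  refine ⟨hc 1 h1, ?_⟩
  have hpana : ∀ γ, AnalyticOnNhd ℝ (fun t => evalTuple p (c t * γ)) (Set.Icc 0 1) := by
    intro γ
    refine AnalyticOnNhd.aeval_mvPolynomial (fun q => ?_) p
    simp only [Pi.mul_apply, Matrix.mul_apply]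
    exact Finset.analyticOnNhd_fun_sum _ fun k _ => (hana _ _ _).mul analyticOnNhd_const
  let τ : ℕ → ℝ := fun n => 1 / ((n : ℝ) + 1)
  have hτ : ∀ n, τ n ∈ Set.Icc (0 : ℝ) 1 := fun n =>
    ⟨by positivity, by rw [div_le_one (by positivity)]; linarith [n.cast_nonneg (α := ℝ)]⟩
  have hτ0 : Tendsto τ atTop (𝓝 0) := tendsto_one_div_add_atTop_nhds_zero_nat
  have hτne : Tendsto τ atTop (𝓝[≠] 0) :=
    tendsto_nhdsWithin_iff.2 ⟨hτ0, Eventually.of_forall fun n => by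
      simp only [τ, Set.mem_compl_iff, Set.mem_singleton_iff]; positivity⟩
  let g : ℕ → Fin r → Matrix (Fin d) (Fin d) ℝ := fun n s => c 1 s * (c (τ n) s).transpose
  have hgc : ∀ n, g n * c (τ n) = c 1 := fun n => funext fun s => by
    simp only [g, Pi.mul_apply, Matrix.mul_assoc, (hc _ (hτ n) s).1, Matrix.mul_one]
  have hglim : Tendsto g atTop (𝓝 (c 1)) := by
    have hcont : ContinuousAt c 0 := by
      refine continuousAt_pi.2 fun s => continuousAt_pi.2 fun i => continuousAt_pi.2 fun j => ?_
      exact (hana s i j 0 h0).continuousAt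
    have hlim : Tendsto (fun n => c (τ n)) atTop (𝓝 1) := hc0 ▸ hcont.tendsto.comp hτ0
    have hΦ : Continuous fun M : Fin r → Matrix (Fin d) (Fin d) ℝ =>
        fun s => c 1 s * (M s).transpose := by fun_prop
    have hΦ1 : (fun s => c 1 s * ((1 : Fin r → Matrix (Fin d) (Fin d) ℝ) s).transpose) = c 1 := by
      simp
    exact hΦ1 ▸ (hΦ.tendsto 1).comp hlim
  let A : ℕ → Set (Fin r → Matrix (Fin d) (Fin d) ℝ) := fun n =>
    {γ | evalTuple p γ = 0 ∧ evalTuple p (g n * γ) ≠ 0}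
  let B : ℕ → Set (Fin r → Matrix (Fin d) (Fin d) ℝ) := fun n =>
    {γ | evalTuple p (c (τ n) * γ) = 0 ∧ evalTuple p (c 1 * γ) ≠ 0}
  have hA : ∀ n, MeasurableSet (A n) := fun n => by
    simpa only [one_mul] using measurableSet_evalTuple_eq_zero_ne_zero p 1 (g n)
  have hAB : ∀ n, ν (A n) = ν (B n) := fun n => by
    rw [← measure_preimage_mul_left hinv (hc _ (hτ n)) (hA n)]
    simp only [A, B, Set.mem_ofPred_eq, ← mul_assoc, hgc]
  have hBlim : Tendsto (fun n => ν (B n)) atTop (𝓝 0) := by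
    rw [← measure_empty (μ := ν)]
    refine tendsto_measure_of_tendsto_indicator_of_isFiniteMeasure _ ν
      (fun n => measurableSet_evalTuple_eq_zero_ne_zero p _ _) fun γ => ?_
    by_contra hcon
    have hfreq : ∃ᶠ n in atTop, γ ∈ B n := fun h => hcon (by simpa using h)
    have hzero := (hpana γ).eqOn_zero_of_preconnected_of_frequently_eq_zero
      isPreconnected_Icc h0 (hτne.frequently (hfreq.mono fun n hn => hn.1))
    obtain ⟨n, hn⟩ := hfreq.exists
    exact hn.2 (hzero h1)
  set A₀ : Set (Fin r → Matrix (Fin d) (Fin d) ℝ) :=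
    {γ | evalTuple p γ = 0 ∧ evalTuple p (c 1 * γ) ≠ 0} with hA₀
  have hA₀m : MeasurableSet A₀ := by
    simpa only [one_mul] using measurableSet_evalTuple_eq_zero_ne_zero p 1 (c 1)
  have hAlim : Tendsto (fun n => ν (A₀ ∩ A n)) atTop (𝓝 (ν A₀)) := by
    refine tendsto_measure_of_tendsto_indicator_of_isFiniteMeasure _ ν
      (fun n => hA₀m.inter (hA n)) fun γ => ?_
    by_cases hγ : γ ∈ A₀
    · have hlim : Tendsto (fun n => evalTuple p (g n * γ)) atTop (𝓝 (evalTuple p (c 1 * γ))) :=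
        ((continuous_evalTuple p).tendsto _).comp (hglim.mul_const γ)
      filter_upwards [hlim.eventually_ne hγ.2] with n hn
      exact ⟨fun h => h.1, fun h => ⟨h, h.1, hn⟩⟩
    · exact Eventually.of_forall fun n => by simp [hγ]
  refine le_antisymm (le_of_tendsto_of_tendsto' hAlim hBlim fun n => ?_) bot_le
  exact (measure_mono Set.inter_subset_right).trans_eq (hAB n)

lemma mulSingle_householder_mem_zeroSetStabilizer [IsProbabilityMeasure ν]
    (p : MvPolynomial (Fin r × Fin d × Fin d) ℚ)
    (hinv : ∀ g : Fin r → Matrix (Fin d) (Fin d) ℝ, (∀ s, g s ∈ SOSet d) →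
      Measure.map (fun β s => g s * β s) ν = ν)
    (s : Fin r) {u v : Fin d → ℝ} (hu : u ≠ 0) (hv : v ≠ 0) :
    Pi.mulSingle s (householder u * householder v) ∈ zeroSetStabilizer p hinv := by
  wlog huv : 0 ≤ u ⬝ᵥ v generalizing u
  · rw [← householder_neg u]
    exact this (neg_ne_zero.2 hu) (by rw [neg_dotProduct]; linarith)
  have huu : 0 < u ⬝ᵥ u := (Matrix.dotProduct_self_star_pos_iff (v := u)).2 hu
  have hvv : 0 < v ⬝ᵥ v := (Matrix.dotProduct_self_star_pos_iff (v := v)).2 hv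
  let w : ℝ → Fin d → ℝ := fun t => (1 - t) • v + t • u
  have hw : ∀ t ∈ Set.Icc (0 : ℝ) 1, w t ⬝ᵥ w t ≠ 0 := by
    rintro t ⟨ht0, ht1⟩
    have : w t ⬝ᵥ w t = (1 - t) ^ 2 * (v ⬝ᵥ v) + 2 * ((1 - t) * t * (u ⬝ᵥ v)) +
        t ^ 2 * (u ⬝ᵥ u) := by
      simp only [w, dotProduct_add, add_dotProduct, smul_dotProduct, dotProduct_smul,
        smul_eq_mul, dotProduct_comm v u]
      ring
    rw [this]
    have h3 : 0 ≤ (1 - t) * t * (u ⬝ᵥ v) := mul_nonneg (mul_nonneg (by linarith) ht0) huv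
    rcases ht0.eq_or_lt with rfl | ht
    · simpa using hvv.ne'
    · have := mul_pos (pow_pos ht 2) huu
      have := mul_nonneg (sq_nonneg (1 - t)) hvv.le
      linarith
  have hwa : ∀ i, AnalyticOnNhd ℝ (fun t => w t i) (Set.Icc 0 1) := fun i t _ => by
    simp only [w, Pi.add_apply, Pi.smul_apply, smul_eq_mul]
    fun_prop
  have hha : ∀ i j, AnalyticOnNhd ℝ (fun t => householder (w t) i j) (Set.Icc 0 1) := by
    intro i j
    simp only [householder, Matrix.sub_apply, Matrix.smul_apply, Matrix.vecMulVec_apply,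
      smul_eq_mul]
    refine analyticOnNhd_const.sub ((analyticOnNhd_const.div ?_ hw).mul ((hwa i).mul (hwa j)))
    exact Finset.analyticOnNhd_fun_sum _ fun k _ => (hwa k).mul (hwa k)
  have hw1 : w 1 = u := by simp [w]
  have hw0 : w 0 = v := by simp [w]
  rw [← hw1]
  refine endpoint_mem_zeroSetStabilizer p hinv
    (c := fun t => Pi.mulSingle s (householder (w t) * householder v)) ?_ ?_ ?_
  · simp [hw0, householder_mul_self]
  · intro t ht s'
    rcases eq_or_ne s' s with rfl | hs
    · rw [Pi.mulSingle_eq_same]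
      refine householder_mul_householder_mem_SOSet (fun h => hw t ht ?_) hv
      simp [h]
    · rw [Pi.mulSingle_eq_of_ne hs]
      exact one_mem_SOSet
  · intro s' i j
    rcases eq_or_ne s' s with rfl | hs
    · simp only [Pi.mulSingle_eq_same, Matrix.mul_apply]
      exact Finset.analyticOnNhd_fun_sum _ fun k _ => (hha i k).mul analyticOnNhd_const
    · simp only [Pi.mulSingle_eq_of_ne hs]
      exact analyticOnNhd_const

lemma mem_zeroSetStabilizer [IsProbabilityMeasure ν]
    (p : MvPolynomial (Fin r × Fin d × Fin d) ℚ)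
    (hinv : ∀ g : Fin r → Matrix (Fin d) (Fin d) ℝ, (∀ s, g s ∈ SOSet d) →
      Measure.map (fun β s => g s * β s) ν = ν)
    {g : Fin r → Matrix (Fin d) (Fin d) ℝ} (hg : ∀ s, g s ∈ SOSet d) :
    g ∈ zeroSetStabilizer p hinv := by
  refine Submonoid.pi_mem_of_mulSingle_mem g fun s => ?_
  exact SOSet_subset_of_householder_mul_mem
    (H := (zeroSetStabilizer p hinv).comap (MonoidHom.mulSingle (fun _ => Matrix (Fin d) (Fin d) ℝ) s))
    (fun u v hu hv => mulSingle_householder_mem_zeroSetStabilizer p hinv s hu hv) (hg s)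

lemma measure_evalTuple_eq_zero [IsProbabilityMeasure ν]
    (p : MvPolynomial (Fin r × Fin d × Fin d) ℚ)
    (hinv : ∀ g : Fin r → Matrix (Fin d) (Fin d) ℝ, (∀ s, g s ∈ SOSet d) →
      Measure.map (fun β s => g s * β s) ν = ν)
    {β : Fin r → Matrix (Fin d) (Fin d) ℝ} (hβ : ∀ s, β s ∈ SOSet d) (hpβ : evalTuple p β ≠ 0) :
    ν {γ | (∀ s, γ s ∈ SOSet d) ∧ evalTuple p γ = 0} = 0 := by
  obtain ⟨T, hTG, hT, hTU⟩ := TopologicalSpace.isOpen_biUnion_countable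
    {g : Fin r → Matrix (Fin d) (Fin d) ℝ | ∀ s, g s ∈ SOSet d}
    (fun g => {γ | evalTuple p (g * γ) ≠ 0})
    (fun g _ => isOpen_ne_fun
      ((continuous_evalTuple p).comp (continuous_const.mul continuous_id)) continuous_const)
  refine measure_mono_null ?_ ((measure_biUnion_null_iff hT).2
    fun g hg => (mem_zeroSetStabilizer p hinv (hTG hg)).2)
  rintro γ ⟨hγ, hpγ⟩
  have hmem : γ ∈ ⋃ g ∈ {g : Fin r → Matrix (Fin d) (Fin d) ℝ | ∀ s, g s ∈ SOSet d},
      {γ | evalTuple p (g * γ) ≠ 0} := by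
    refine Set.mem_biUnion (x := fun s => β s * (γ s).transpose)
      (fun s => mul_mem_SOSet (hβ s) (transpose_mem_SOSet (hγ s))) ?_
    have : (fun s => β s * (γ s).transpose) * γ = β := funext fun s => by
      simp only [Pi.mul_apply, Matrix.mul_assoc, (hγ s).1, Matrix.mul_one]
    rwa [Set.mem_ofPred_eq, this]
  rw [← hTU] at hmem
  obtain ⟨g, hg, hgγ⟩ := Set.mem_iUnion₂.1 hmem
  exact Set.mem_biUnion hg ⟨hpγ, hgγ⟩

end SOSet

/-- The non-generic tuples form a Haar-null set: any left-invariant Borel probability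
measure concentrated on `SO(d)^r` (i.e., any Haar measure of the compact group `SO(d)^r`,
viewed as a measure on the ambient space of `r`-tuples of matrices) assigns measure zero
to the set of non-generic `r`-tuples in `SO(d)^r`. -/
theorem nongeneric_haar_null (d r : ℕ) (hd : 2 ≤ d) (hr : 1 ≤ r)
    (ν : Measure (Fin r → Matrix (Fin d) (Fin d) ℝ))
    (hprob : IsProbabilityMeasure ν)
    (hconc : ν {γ | ¬ ∀ s, γ s ∈ SOSet d} = 0)
    (hinv : ∀ g : Fin r → Matrix (Fin d) (Fin d) ℝ, (∀ s, g s ∈ SOSet d) →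
      Measure.map (fun β s => g s * β s) ν = ν) :
    ν {γ | (∀ s, γ s ∈ SOSet d) ∧ ¬ IsGeneric γ} = 0 := by
  let P : Set (MvPolynomial (Fin r × Fin d × Fin d) ℚ) :=
    {p | ∃ β : Fin r → Matrix (Fin d) (Fin d) ℝ, (∀ s, β s ∈ SOSet d) ∧ evalTuple p β ≠ 0}
  have hcount : Countable (MvPolynomial (Fin r × Fin d × Fin d) ℚ) :=
    Cardinal.mk_le_aleph0_iff.1 (MvPolynomial.cardinalMk_le_max.trans
      (max_le (max_le Cardinal.mk_le_aleph0 Cardinal.mk_le_aleph0) le_rfl))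
  refine measure_mono_null ?_ ((measure_biUnion_null_iff P.to_countable).2
    fun p ⟨β, hβ, hpβ⟩ => measure_evalTuple_eq_zero p hinv hβ hpβ)
  rintro γ ⟨hγ, hgen⟩
  simp only [IsGeneric, not_forall] at hgen
  obtain ⟨p, hp, β, hβ, hpβ⟩ := hgen
  exact Set.mem_biUnion (x := p) ⟨β, hβ, hpβ⟩ ⟨hγ, hp⟩
end

section
/- Let r ≥ 1, d ≥ 2, and γ = (γ₁,…,γ_r) ∈ SO(d)^r. Then γ is generic if and only if the (d choose 2)·r-tuple consisting of all matrix entries of γ₁,…,γ_r lying strictly above the diagonals (i.e. the entries (γ_s)_{i,j} for s ∈ [r] and 1 ≤ i < j ≤ d) is algebraically independent over ℚ. -/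
open Matrix

section Cayley

variable {n : Type*} [Fintype n] [DecidableEq n]

/-- The Cayley transform `(1 - A) (1 + A)⁻¹` of a square real matrix. -/
noncomputable def cayley (A : Matrix n n ℝ) : Matrix n n ℝ := (1 - A) * (1 + A)⁻¹

lemma det_one_add_ne_zero_of_skew {X : Matrix n n ℝ} (hX : Xᵀ = -X) : (1 + X).det ≠ 0 := by
  intro h
  obtain ⟨v, hv, hXv⟩ := exists_mulVec_eq_zero_iff.mpr h
  rw [add_mulVec, one_mulVec] at hXv
  have h0 : v ⬝ᵥ X *ᵥ v = 0 := by
    have h1 : v ⬝ᵥ X *ᵥ v = -(v ⬝ᵥ X *ᵥ v) := by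
      conv_lhs => rw [dotProduct_mulVec, ← mulVec_transpose, hX, dotProduct_comm, neg_mulVec,
        dotProduct_neg]
    linarith
  have h2 : v ⬝ᵥ v = 0 := by
    have := congrArg (v ⬝ᵥ ·) hXv
    simpa [dotProduct_add, h0] using this
  exact hv (dotProduct_self_eq_zero.mp h2)

lemma one_add_cayley {A : Matrix n n ℝ} (hA : (1 + A).det ≠ 0) :
    1 + cayley A = (2 : ℝ) • (1 + A)⁻¹ := by
  have h : (1 + A) * (1 + A)⁻¹ = 1 := mul_nonsing_inv _ hA.isUnit
  calc 1 + cayley A = (1 + A) * (1 + A)⁻¹ + (1 - A) * (1 + A)⁻¹ := by rw [h, cayley]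
    _ = ((2 : ℝ) • (1 : Matrix n n ℝ)) * (1 + A)⁻¹ := by
      rw [← add_mul, two_smul]; congr 1; abel
    _ = _ := by rw [smul_mul_assoc, one_mul]

lemma det_one_add_cayley_ne_zero {A : Matrix n n ℝ} (hA : (1 + A).det ≠ 0) :
    (1 + cayley A).det ≠ 0 := by
  have h : (1 + A) * (1 + A)⁻¹ = 1 := mul_nonsing_inv _ hA.isUnit
  have h' := congrArg det h
  rw [det_mul, det_one] at h'
  rw [one_add_cayley hA, det_smul]
  exact mul_ne_zero (by positivity) (right_ne_zero_of_mul_eq_one h')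

lemma cayley_cayley {A : Matrix n n ℝ} (hA : (1 + A).det ≠ 0) : cayley (cayley A) = A := by
  have h1 := one_add_cayley hA
  have h2 : (1 + cayley A)⁻¹ = (2⁻¹ : ℝ) • (1 + A) := by
    apply inv_eq_right_inv
    rw [h1, smul_mul_smul_comm, nonsing_inv_mul _ hA.isUnit]
    norm_num
  have h3 : 1 - cayley A = (2 : ℝ) • 1 - (2 : ℝ) • (1 + A)⁻¹ := by
    rw [← h1, two_smul]; abel
  rw [cayley, h2, h3, ← smul_sub, smul_mul_smul_comm, sub_mul, nonsing_inv_mul _ hA.isUnit]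
  norm_num

lemma det_eq_one_of_det_add_ne_zero {D M : Matrix n n ℝ} (hD : Dᵀ * D = 1) (hM : Mᵀ * M = 1)
    (hdet : M.det = 1) (h : (D + M).det ≠ 0) : D.det = 1 := by
  have hD' : D * Dᵀ = 1 := mul_eq_one_comm.mp hD
  have key : D * (D + M)ᵀ * M = D + M := by
    rw [transpose_add, mul_add, add_mul, hD', one_mul, mul_assoc, hM, mul_one, add_comm]
  have := congrArg det key
  rw [det_mul, det_mul, det_transpose, hdet, mul_one] at this
  exact mul_right_cancel₀ h (by rw [this, one_mul])

lemma transpose_cayley_mul_cayley_of_skew {X : Matrix n n ℝ} (hX : Xᵀ = -X) :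
    (cayley X)ᵀ * cayley X = 1 := by
  have hu := (det_one_add_ne_zero_of_skew hX).isUnit
  have hu' : IsUnit (1 - X).det := by
    rw [← det_transpose, transpose_sub, hX, transpose_one, sub_neg_eq_add]; exact hu
  have ht : (cayley X)ᵀ = (1 - X)⁻¹ * (1 + X) := by
    rw [cayley, transpose_mul, transpose_nonsing_inv, transpose_add, transpose_sub, hX,
      transpose_one, sub_neg_eq_add, ← sub_eq_add_neg]
  have hc : (1 + X) * (1 - X) = (1 - X) * (1 + X) := by noncomm_ring
  rw [ht, cayley, mul_assoc, ← mul_assoc (1 + X), hc, mul_assoc, mul_nonsing_inv _ hu, mul_one,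
    nonsing_inv_mul _ hu']

lemma det_cayley_of_skew {X : Matrix n n ℝ} (hX : Xᵀ = -X) : (cayley X).det = 1 := by
  refine det_eq_one_of_det_add_ne_zero (M := 1) (transpose_cayley_mul_cayley_of_skew hX)
    (by simp) (by simp) ?_
  rw [add_comm]
  exact det_one_add_cayley_ne_zero (det_one_add_ne_zero_of_skew hX)

lemma transpose_cayley_of_orthogonal {N : Matrix n n ℝ} (hN : Nᵀ * N = 1)
    (h : (1 + N).det ≠ 0) : (cayley N)ᵀ = -cayley N := by
  have hu := h.isUnit
  have hu' : IsUnit (1 + Nᵀ).det := by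
    rw [← det_transpose, transpose_add, transpose_transpose, transpose_one]; exact hu
  have key : (1 - Nᵀ) * (1 + N) = -((1 + Nᵀ) * (1 - N)) := by
    simp only [mul_add, mul_sub, add_mul, sub_mul, hN, one_mul, mul_one]; abel
  have ht : (cayley N)ᵀ = (1 + Nᵀ)⁻¹ * (1 - Nᵀ) := by
    rw [cayley, transpose_mul, transpose_nonsing_inv, transpose_add, transpose_sub, transpose_one]
  calc (cayley N)ᵀ = (1 + Nᵀ)⁻¹ * ((1 - Nᵀ) * (1 + N)) * (1 + N)⁻¹ := by
        rw [ht, ← mul_assoc, mul_assoc _ (1 + N), mul_nonsing_inv _ hu, mul_one]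
    _ = -cayley N := by
        rw [key, mul_neg, ← mul_assoc, nonsing_inv_mul _ hu', one_mul, neg_mul, cayley]

end Cayley

section Signs

variable {n : Type*} [Fintype n] [DecidableEq n]

/-- Any square matrix becomes invertible after adding a suitable diagonal sign matrix. -/
lemma exists_sign_diagonal_add_det_ne_zero (M : Matrix n n ℝ) :
    ∃ S : Finset n, (diagonal (fun i => if i ∈ S then (-1 : ℝ) else 1) + M).det ≠ 0 := by
  suffices H : ∀ T : Finset n, ∃ S : Finset n,
      (of fun i => if i ∈ T then Pi.single i (if i ∈ S then (-1 : ℝ) else 1) + M i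
        else Pi.single i 1).det ≠ 0 by
    obtain ⟨S, hS⟩ := H Finset.univ
    refine ⟨S, ?_⟩
    convert hS using 2
    ext i j
    simp [diagonal_apply, Pi.single_apply, eq_comm]
  intro T
  induction T using Finset.induction_on with
  | empty =>
    refine ⟨∅, ?_⟩
    have : (of fun i : n => (Pi.single i 1 : n → ℝ)) = 1 := by
      ext i j; simp [one_apply, Pi.single_apply, eq_comm]
    simp [this]
  | insert a T ha ih =>
    obtain ⟨S, hS⟩ := ih
    set A : Matrix n n ℝ := of fun i => if i ∈ T then
      Pi.single i (if i ∈ S then (-1 : ℝ) else 1) + M i else Pi.single i 1 with hA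
    have hAa : A a = Pi.single a 1 := if_neg ha
    have hrow : A.updateRow a (Pi.single a 1) = A := by rw [← hAa, updateRow_eq_self]
    have hneg : A.updateRow a (Pi.single a (-1)) = A.updateRow a ((-1 : ℝ) • Pi.single a 1) := by
      rw [← Pi.single_smul]; simp
    have hplus : (A.updateRow a (Pi.single a 1 + M a)).det
        = A.det + (A.updateRow a (M a)).det := by rw [det_updateRow_add, hrow]
    have hminus : (A.updateRow a (Pi.single a (-1) + M a)).det
        = -A.det + (A.updateRow a (M a)).det := by
      rw [det_updateRow_add, hneg, det_updateRow_smul, hrow]; ring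
    by_cases h : (A.updateRow a (Pi.single a 1 + M a)).det = 0
    · refine ⟨insert a S, ?_⟩
      convert_to (A.updateRow a (Pi.single a (-1) + M a)).det ≠ 0
      · congr 1
        ext i j
        by_cases hi : i = a
        · subst hi; simp
        · simp [hi, hA, updateRow_ne]
      · intro h'
        rw [hplus] at h; rw [hminus] at h'
        exact hS (by linarith)
    · refine ⟨S.erase a, ?_⟩
      convert h using 2
      ext i j
      by_cases hi : i = a
      · subst hi; simp
      · simp [hi, hA, updateRow_ne]

/-- On an even set of coordinates there is an orthogonal complex structure. -/
lemma exists_skew_sq_eq_neg {S : Finset n} (hS : Even S.card) :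
    ∃ J : Matrix n n ℝ, Jᵀ = -J ∧
      J * J = -diagonal (fun i => if i ∈ S then (1 : ℝ) else 0) ∧
      J * diagonal (fun i => if i ∈ S then (1 : ℝ) else 0) = J := by
  obtain ⟨k, hk⟩ := hS
  have e : Fin k × Fin 2 ≃ S := Fintype.equivOfCardEq (by simp [hk]; ring)
  let B : Matrix n (Fin k × Fin 2) ℝ := of fun i q => if i = (e q : n) then 1 else 0
  let K : Matrix (Fin k × Fin 2) (Fin k × Fin 2) ℝ :=
    kroneckerMap (· * ·) (1 : Matrix (Fin k) (Fin k) ℝ) !![0, 1; -1, 0]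
  have hBB : Bᵀ * B = 1 := by
    ext p q
    simp [B, mul_apply, one_apply, Subtype.ext_iff.symm, eq_comm]
  have hP : B * Bᵀ = diagonal (fun i => if i ∈ S then (1 : ℝ) else 0) := by
    ext i j
    rw [mul_apply]
    change ∑ q, (if i = (e q : n) then (1 : ℝ) else 0) * (if j = (e q : n) then 1 else 0) = _
    rw [e.sum_comp (fun s : S => (if i = (s : n) then (1 : ℝ) else 0) *
      (if j = (s : n) then 1 else 0))]
    rw [Finset.sum_coe_sort S (fun s => (if i = s then (1 : ℝ) else 0) *
      (if j = s then 1 else 0))]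
    by_cases hij : i = j
    · subst hij; simp
    · rw [diagonal_apply_ne _ hij]
      refine Finset.sum_eq_zero fun s _ => ?_
      by_cases h : i = s
      · have h' : j ≠ s := fun h' => hij (h.trans h'.symm)
        simp [h']
      · simp [h]
  have hKt : Kᵀ = -K := by
    ext ⟨a, b⟩ ⟨c, d⟩
    fin_cases b <;> fin_cases d <;> simp [K, one_apply, eq_comm]
  have hKK : K * K = -1 := by
    rw [show K * K = kroneckerMap (· * ·) (1 * 1 : Matrix (Fin k) (Fin k) ℝ)
      (!![0, 1; -1, 0] * !![0, 1; -1, 0]) from (mul_kronecker_mul _ _ _ _).symm]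
    ext ⟨a, b⟩ ⟨c, d⟩
    fin_cases b <;> fin_cases d <;> simp [one_apply]
  refine ⟨B * K * Bᵀ, ?_, ?_, ?_⟩
  · rw [transpose_mul, transpose_mul, transpose_transpose, hKt]
    simp [Matrix.mul_assoc]
  · calc B * K * Bᵀ * (B * K * Bᵀ) = B * K * (Bᵀ * B) * K * Bᵀ := by simp only [Matrix.mul_assoc]
      _ = B * (K * K) * Bᵀ := by rw [hBB, Matrix.mul_one, Matrix.mul_assoc B]
      _ = _ := by rw [hKK, ← hP]; simp
  · calc B * K * Bᵀ * diagonal (fun i => if i ∈ S then (1 : ℝ) else 0)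
        = B * K * (Bᵀ * B) * Bᵀ := by rw [← hP]; simp only [Matrix.mul_assoc]
      _ = _ := by rw [hBB, Matrix.mul_one]

/-- For every rotation `M` there is a skew-symmetric `X` such that `M` plus the Cayley transform
of `X` is invertible; the condition is stated with the denominator `1 + X` cleared. -/
lemma exists_skew_det_ne_zero {M : Matrix n n ℝ} (hM : Mᵀ * M = 1) (hdet : M.det = 1) :
    ∃ X : Matrix n n ℝ, Xᵀ = -X ∧ ((1 - X) + M * (1 + X)).det ≠ 0 := by
  obtain ⟨S, hS⟩ := exists_sign_diagonal_add_det_ne_zero M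
  set D : Matrix n n ℝ := diagonal (fun i => if i ∈ S then (-1 : ℝ) else 1) with hD
  have hDD : Dᵀ * D = 1 := by
    rw [hD, diagonal_transpose, diagonal_mul_diagonal, ← diagonal_one]
    congr 1; ext i; split_ifs <;> norm_num
  have hD1 : D.det = 1 := det_eq_one_of_det_add_ne_zero hDD hM hdet hS
  have heven : Even S.card := by
    rw [hD, det_diagonal, Finset.prod_ite] at hD1
    refine (neg_one_pow_eq_one_iff_even (R := ℝ) (by norm_num)).mp ?_
    simpa [Finset.filter_mem_eq_inter] using hD1
  obtain ⟨J, hJt, hJJ, hJP⟩ := exists_skew_sq_eq_neg heven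
  set P : Matrix n n ℝ := diagonal (fun i => if i ∈ S then (1 : ℝ) else 0) with hP
  have hPt : Pᵀ = P := diagonal_transpose _
  have hPJ : P * J = J := by
    have := congrArg transpose hJP
    rw [transpose_mul, hPt, hJt, mul_neg] at this
    exact neg_injective this
  have hPP : P * P = P := by
    rw [hP, diagonal_mul_diagonal]; congr 1; ext i; split_ifs <;> norm_num
  have hDP : D = 1 - P - P := by
    rw [hD, hP, ← diagonal_one, diagonal_sub, diagonal_sub]
    congr 1; ext i; split_ifs <;> norm_num
  let f : ℝ → ℝ := fun s => ((1 - P + s • P - J) + M * (1 - P + s • P + J)).det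
  have hfc : Continuous f := by
    apply Continuous.matrix_det
    fun_prop
  have hQ : (1 - P - J) * (1 - P + J) = 1 := by
    have : (1 - P - J) * (1 - P + J) = 1 - P - P + P * P + J - P * J - J + J * P - J * J := by
      noncomm_ring
    rw [this, hPP, hPJ, hJP, hJJ]; abel
  have hQQ : (1 - P - J) * (1 - P - J) = D := by
    have : (1 - P - J) * (1 - P - J) = 1 - P - P + P * P - J + P * J - J + J * P + J * J := by
      noncomm_ring
    rw [this, hPP, hPJ, hJP, hJJ, hDP]; abel
  have hf0 : f 0 ≠ 0 := by
    have : (1 - P + (0 : ℝ) • P - J) + M * (1 - P + (0 : ℝ) • P + J) = (D + M) * (1 - P + J) := by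
      rw [zero_smul, add_zero, add_mul, ← hQQ, mul_assoc, hQ, mul_one]
    change det _ ≠ 0
    rw [this, det_mul]
    refine mul_ne_zero hS (right_ne_zero_of_mul_eq_one (a := (1 - P - J).det) ?_)
    rw [← det_mul, hQ, det_one]
  have hev : ∀ᶠ s in nhdsWithin (0 : ℝ) {0}ᶜ, f s ≠ 0 ∧ s ≠ 0 :=
    ((hfc.continuousAt.eventually_ne hf0).filter_mono nhdsWithin_le_nhds).and
      self_mem_nhdsWithin
  obtain ⟨s, hfs, hs⟩ := hev.exists
  refine ⟨s⁻¹ • J, by rw [transpose_smul, hJt, smul_neg], fun h0 => hfs ?_⟩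
  have hXU : s⁻¹ • J * (1 - P + s • P) = J := by
    rw [mul_add, mul_sub, mul_one, smul_mul_smul_comm, inv_mul_cancel₀ hs, smul_mul_assoc, hJP,
      sub_self, zero_add, one_smul]
  have : (1 - P + s • P - J) + M * (1 - P + s • P + J)
      = ((1 - s⁻¹ • J) + M * (1 + s⁻¹ • J)) * (1 - P + s • P) := by
    rw [add_mul, sub_mul, mul_assoc M, add_mul 1, hXU, one_mul]
  change det _ = 0
  rw [this, det_mul, h0, zero_mul]

end Signs

open MvPolynomial in
/-- The real functions of `τ → ℝ` that are quotients of rational polynomials whose denominator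
has no real zero. -/
def regularFunctions (τ : Type*) : Subalgebra ℚ ((τ → ℝ) → ℝ) where
  carrier := {g | ∃ F G : MvPolynomial τ ℚ, ∀ x, aeval x G ≠ 0 ∧ aeval x F = aeval x G * g x}
  mul_mem' := by
    rintro g g' ⟨F, G, h⟩ ⟨F', G', h'⟩
    refine ⟨F * F', G * G', fun x => ⟨?_, ?_⟩⟩
    · rw [map_mul]; exact mul_ne_zero (h x).1 (h' x).1
    · rw [map_mul, map_mul, (h x).2, (h' x).2, Pi.mul_apply]; ring
  add_mem' := by
    rintro g g' ⟨F, G, h⟩ ⟨F', G', h'⟩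
    refine ⟨F * G' + F' * G, G * G', fun x => ⟨?_, ?_⟩⟩
    · rw [map_mul]; exact mul_ne_zero (h x).1 (h' x).1
    · rw [map_add, map_mul, map_mul, map_mul, (h x).2, (h' x).2, Pi.add_apply]; ring
  algebraMap_mem' c := ⟨C c, 1, fun x => by simp⟩

namespace regularFunctions

variable {τ : Type*}

lemma coord_mem (q : τ) : (fun x : τ → ℝ => x q) ∈ regularFunctions τ :=
  ⟨MvPolynomial.X q, 1, fun x => by simp⟩

lemma const_mem (c : ℚ) : (fun _ : τ → ℝ => (c : ℝ)) ∈ regularFunctions τ :=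
  (regularFunctions τ).algebraMap_mem c

lemma inv_mem {g : (τ → ℝ) → ℝ} (hg : g ∈ regularFunctions τ) (h0 : ∀ x, g x ≠ 0) :
    (fun x => (g x)⁻¹) ∈ regularFunctions τ := by
  obtain ⟨F, G, h⟩ := hg
  refine ⟨G, F, fun x => ⟨?_, ?_⟩⟩
  · rw [(h x).2]; exact mul_ne_zero (h x).1 (h0 x)
  · rw [(h x).2, mul_inv_cancel_right₀ (h0 x)]

lemma aeval_mem {σ : Type*} {g : σ → (τ → ℝ) → ℝ} (hg : ∀ i, g i ∈ regularFunctions τ)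
    (p : MvPolynomial σ ℚ) :
    (fun x => MvPolynomial.aeval (fun i => g i x) p) ∈ regularFunctions τ := by
  have h : (fun x => MvPolynomial.aeval (fun i => g i x) p) = MvPolynomial.aeval g p := by
    ext x
    have := MvPolynomial.map_aeval g (Pi.evalRingHom (fun _ : τ → ℝ => ℝ) x) p
    simp only [Pi.evalRingHom_apply] at this
    rw [this]
    rw [MvPolynomial.aeval_def, MvPolynomial.coe_eval₂Hom]
    congr 1
  rw [h]
  clear h
  induction p using MvPolynomial.induction_on with
  | C a => simp
  | add p q hp hq => rw [map_add]; exact Subalgebra.add_mem _ hp hq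
  | mul_X p i hp =>
    rw [map_mul, MvPolynomial.aeval_X]; exact Subalgebra.mul_mem _ hp (hg i)

variable {n : Type*} [Fintype n]

lemma mul_matrix_mem {A B : (τ → ℝ) → Matrix n n ℝ}
    (hA : ∀ i j, (fun x => A x i j) ∈ regularFunctions τ)
    (hB : ∀ i j, (fun x => B x i j) ∈ regularFunctions τ) (i j : n) :
    (fun x => (A x * B x) i j) ∈ regularFunctions τ := by
  have : (fun x => (A x * B x) i j) = ∑ k, (fun x => A x i k) * (fun x => B x k j) := by
    ext x; simp [Matrix.mul_apply]
  rw [this]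
  exact Subalgebra.sum_mem _ fun k _ => Subalgebra.mul_mem _ (hA i k) (hB k j)

variable [DecidableEq n]

lemma det_mem {A : (τ → ℝ) → Matrix n n ℝ}
    (hA : ∀ i j, (fun x => A x i j) ∈ regularFunctions τ) :
    (fun x => (A x).det) ∈ regularFunctions τ := by
  have : (fun x => (A x).det)
      = ∑ σ : Equiv.Perm n, (Equiv.Perm.sign σ : ℤ) • ∏ i, fun x => A x (σ i) i := by
    ext x
    simp [Matrix.det_apply, Units.smul_def]
  rw [this]
  exact Subalgebra.sum_mem _ fun σ _ => Subalgebra.zsmul_mem _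
    (Subalgebra.prod_mem _ fun i _ => hA (σ i) i) _

lemma inv_matrix_mem {A : (τ → ℝ) → Matrix n n ℝ}
    (hA : ∀ i j, (fun x => A x i j) ∈ regularFunctions τ) (h0 : ∀ x, (A x).det ≠ 0) (i j : n) :
    (fun x => (A x)⁻¹ i j) ∈ regularFunctions τ := by
  have : (fun x => (A x)⁻¹ i j)
      = (fun x => (A x).det⁻¹) * fun x => ((A x).updateRow j (Pi.single i 1)).det := by
    ext x
    simp [Matrix.inv_def, Matrix.adjugate_apply, Ring.inverse_eq_inv']
  rw [this]
  refine Subalgebra.mul_mem _ (inv_mem (det_mem hA) h0) (det_mem fun k l => ?_)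
  by_cases hk : k = j
  · subst hk
    simp only [Matrix.updateRow_self, Pi.single_apply]
    split_ifs
    · simpa using const_mem (τ := τ) 1
    · simpa using const_mem (τ := τ) 0
  · simpa only [Matrix.updateRow_ne hk] using hA k l

lemma cayley_mem {A : (τ → ℝ) → Matrix n n ℝ}
    (hA : ∀ i j, (fun x => A x i j) ∈ regularFunctions τ) (h0 : ∀ x, (1 + A x).det ≠ 0)
    (i j : n) : (fun x => cayley (A x) i j) ∈ regularFunctions τ := by
  have h1 : ∀ i j : n, (fun _ : τ → ℝ => (1 : Matrix n n ℝ) i j) ∈ regularFunctions τ := by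
    intro i j
    have := const_mem (τ := τ) ((1 : Matrix n n ℚ) i j)
    convert this using 2
    simp only [Matrix.one_apply]; split_ifs <;> simp
  exact mul_matrix_mem (fun i j => Subalgebra.sub_mem _ (h1 i j) (hA i j))
    (inv_matrix_mem (fun i j => Subalgebra.add_mem _ (h1 i j) (hA i j)) h0) i j

end regularFunctions

/-- A rational function without poles vanishing at an algebraically independent point is zero. -/
lemma eq_zero_of_mem_regularFunctions {τ : Type*} {a : τ → ℝ} (ha : AlgebraicIndependent ℚ a)
    {g : (τ → ℝ) → ℝ} (hg : g ∈ regularFunctions τ) (h : g a = 0) (b : τ → ℝ) : g b = 0 := by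
  obtain ⟨F, G, hFG⟩ := hg
  have hF : F = 0 := (algebraicIndependent_iff.mp ha) F (by rw [(hFG a).2, h, mul_zero])
  have hb := (hFG b).2
  rw [hF, map_zero] at hb
  exact (mul_eq_zero.mp hb.symm).resolve_left (hFG b).1

lemma algebraicIndependent_of_regularFunctions {τ : Type} [Finite τ] {a : τ → ℝ}
    {g : τ → (τ → ℝ) → ℝ} (hg : ∀ q, g q ∈ regularFunctions τ)
    (h : AlgebraicIndependent ℚ fun q => g q a) : AlgebraicIndependent ℚ a := by
  let K := IntermediateField.adjoin ℚ (Set.range a)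
  have hpoly : ∀ F : MvPolynomial τ ℚ, MvPolynomial.aeval a F ∈ K := fun F =>
    IntermediateField.algebra_adjoin_le_adjoin ℚ _
      (Algebra.adjoin_range_eq_range_aeval ℚ a ▸ ⟨F, rfl⟩)
  have hgK : ∀ q, g q a ∈ K := by
    intro q
    obtain ⟨F, G, hFG⟩ := hg q
    have : g q a = MvPolynomial.aeval a F / MvPolynomial.aeval a G := by
      rw [(hFG a).2, mul_div_cancel_left₀ _ (hFG a).1]
    rw [this]
    exact K.div_mem (hpoly F) (hpoly G)
  let x : τ → K := fun q => ⟨a q, IntermediateField.subset_adjoin ℚ _ ⟨q, rfl⟩⟩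
  let u : τ → K := fun q => ⟨g q a, hgK q⟩
  have hu : AlgebraicIndependent ℚ u := AlgebraicIndependent.of_comp K.val h
  have hxa : ∀ F : MvPolynomial τ ℚ,
      ((MvPolynomial.aeval x F : K) : ℝ) = MvPolynomial.aeval a F := fun F => by
    have := MvPolynomial.comp_aeval_apply (f := x) K.val F
    exact this
  have halg : Algebra.IsAlgebraic (Algebra.adjoin ℚ (Set.range x)) K := by
    have hF : ∀ F : MvPolynomial τ ℚ,
        IsAlgebraic (Algebra.adjoin ℚ (Set.range x)) (MvPolynomial.aeval x F : K) := fun F =>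
      isAlgebraic_algebraMap (⟨_, Algebra.adjoin_range_eq_range_aeval ℚ x ▸ ⟨F, rfl⟩⟩ :
        Algebra.adjoin ℚ (Set.range x))
    refine ⟨fun z => ?_⟩
    obtain ⟨F, G, hz⟩ := (IntermediateField.mem_adjoin_range_iff ℚ a _).mp z.2
    have : z = MvPolynomial.aeval x F * (MvPolynomial.aeval x G)⁻¹ := by
      apply Subtype.ext
      rw [hz, ← div_eq_mul_inv, IntermediateField.coe_div, hxa, hxa]
    rw [this]
    exact (hF F).mul (hF G).inv
  have hx := Algebra.IsAlgebraic.isTranscendenceBasis_of_le_trdeg_of_finite (R := ℚ) x hu.cardinalMk_le_trdeg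
  exact hx.1.map' (f := K.val) K.val.injective

section Skew

variable {d : ℕ}

/-- The skew-symmetric matrix with prescribed entries strictly above the diagonal. -/
def skewOfUpper {R : Type*} [Ring R] (x : {ij : Fin d × Fin d // ij.1 < ij.2} → R) :
    Matrix (Fin d) (Fin d) R :=
  of fun i j => if h : i < j then x ⟨(i, j), h⟩ else if h : j < i then -x ⟨(j, i), h⟩ else 0

lemma transpose_skewOfUpper {R : Type*} [Ring R]
    (x : {ij : Fin d × Fin d // ij.1 < ij.2} → R) : (skewOfUpper x)ᵀ = -skewOfUpper x := by
  ext i j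
  rcases lt_trichotomy i j with h | h | h
  · simp [skewOfUpper, h, h.not_gt]
  · subst h; simp [skewOfUpper]
  · simp [skewOfUpper, h, h.not_gt]

lemma skewOfUpper_map {R S : Type*} [Ring R] [Ring S] (f : R →+* S)
    (x : {ij : Fin d × Fin d // ij.1 < ij.2} → R) :
    (skewOfUpper x).map f = skewOfUpper fun q => f (x q) := by
  ext i j
  rcases lt_trichotomy i j with h | h | h
  · simp [skewOfUpper, h]
  · subst h; simp [skewOfUpper]
  · simp [skewOfUpper, h, h.not_gt]

lemma skewOfUpper_of_skew {X : Matrix (Fin d) (Fin d) ℝ} (hX : Xᵀ = -X) :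
    skewOfUpper (fun q => X q.1.1 q.1.2) = X := by
  ext i j
  have hij : X j i = -X i j := congrFun (congrFun hX i) j
  rcases lt_trichotomy i j with h | h | h
  · simp [skewOfUpper, h]
  · subst h
    have : X i i = 0 := by linarith
    simp [skewOfUpper, this]
  · simp [skewOfUpper, h, h.not_gt, hij]

lemma cayley_skewOfUpper_mem_SOSet (x : {ij : Fin d × Fin d // ij.1 < ij.2} → ℝ) :
    cayley (skewOfUpper x) ∈ SOSet d :=
  ⟨transpose_cayley_mul_cayley_of_skew (transpose_skewOfUpper x),
    det_cayley_of_skew (transpose_skewOfUpper x)⟩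

lemma regularFunctions.skewOfUpper_mem {ι : Type*} (s : ι) (i j : Fin d) :
    (fun x : ι × {ij : Fin d × Fin d // ij.1 < ij.2} → ℝ =>
      skewOfUpper (fun t => x (s, t)) i j) ∈ regularFunctions _ := by
  simp only [skewOfUpper, of_apply]
  split_ifs with h h'
  · exact coord_mem _
  · exact Subalgebra.neg_mem _ (coord_mem _)
  · exact Subalgebra.zero_mem _

lemma exists_rational_eval_ne_zero {τ : Type*} [Finite τ] {f : MvPolynomial τ ℝ} (hf : f ≠ 0) :
    ∃ x : τ → ℚ, MvPolynomial.eval (fun q => (x q : ℝ)) f ≠ 0 := by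
  by_contra! h
  refine hf (MvPolynomial.funext_set (fun _ => Set.range ((↑) : ℚ → ℝ))
    (fun _ => Set.infinite_range_of_injective Rat.cast_injective) fun y hy => ?_)
  choose x hx using fun q => hy q (Set.mem_univ q)
  rw [map_zero, ← h x]
  simp only [hx]

/-- A polynomial in the upper entries `x` whose value is `det ((1 - X) + M (1 + X))`, where
`X` is the skew-symmetric matrix of `x`. -/
lemma exists_polynomial_eval_eq_det (M : Matrix (Fin d) (Fin d) ℝ) :
    ∃ f : MvPolynomial {ij : Fin d × Fin d // ij.1 < ij.2} ℝ, ∀ x,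
      MvPolynomial.eval x f = ((1 - skewOfUpper x) + M * (1 + skewOfUpper x)).det := by
  refine ⟨((1 - skewOfUpper MvPolynomial.X) +
    M.map MvPolynomial.C * (1 + skewOfUpper MvPolynomial.X)).det, fun x => ?_⟩
  rw [RingHom.map_det]
  congr 1
  have hX : (MvPolynomial.eval x).mapMatrix (skewOfUpper MvPolynomial.X) = skewOfUpper x := by
    rw [RingHom.mapMatrix_apply, skewOfUpper_map]
    simp
  have hM : (MvPolynomial.eval x).mapMatrix (M.map MvPolynomial.C) = M := by
    ext i j; simp
  rw [map_add, map_mul, map_sub, map_add, map_one, hX, hM]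

lemma exists_polynomial_ne_zero {M : Matrix (Fin d) (Fin d) ℝ} (hM : M ∈ SOSet d) :
    ∃ f : MvPolynomial {ij : Fin d × Fin d // ij.1 < ij.2} ℝ, f ≠ 0 ∧ ∀ x,
      MvPolynomial.eval x f = ((1 - skewOfUpper x) + M * (1 + skewOfUpper x)).det := by
  obtain ⟨f, hf⟩ := exists_polynomial_eval_eq_det M
  obtain ⟨X, hX, hdet⟩ := exists_skew_det_ne_zero hM.1 hM.2
  refine ⟨f, ?_, hf⟩
  rintro rfl
  rw [← skewOfUpper_of_skew hX, ← hf, map_zero] at hdet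
  exact hdet rfl

/-- Given two rotations, there is a rational orthogonal matrix whose sum with either of them is
invertible. -/
lemma exists_rational_rotation {M M' : Matrix (Fin d) (Fin d) ℝ} (hM : M ∈ SOSet d)
    (hM' : M' ∈ SOSet d) : ∃ R : Matrix (Fin d) (Fin d) ℚ,
      (R.map ((↑) : ℚ → ℝ))ᵀ * R.map ((↑) : ℚ → ℝ) = 1 ∧
      (R.map ((↑) : ℚ → ℝ) + M).det ≠ 0 ∧ (R.map ((↑) : ℚ → ℝ) + M').det ≠ 0 := by
  obtain ⟨f, hf0, hf⟩ := exists_polynomial_ne_zero hM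
  obtain ⟨f', hf0', hf'⟩ := exists_polynomial_ne_zero hM'
  obtain ⟨x, hx⟩ := exists_rational_eval_ne_zero (mul_ne_zero hf0 hf0')
  rw [map_mul, hf, hf'] at hx
  set X := skewOfUpper fun q => (x q : ℝ) with hX
  have hXq : (skewOfUpper x).map (Rat.castHom ℝ) = X := skewOfUpper_map _ x
  have hu : (1 + X).det ≠ 0 := det_one_add_ne_zero_of_skew (transpose_skewOfUpper _)
  have hmap : (1 + skewOfUpper x).map (Rat.castHom ℝ) = 1 + X := by
    rw [← hXq]
    change (Rat.castHom ℝ).mapMatrix _ = _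
    rw [map_add, map_one, RingHom.mapMatrix_apply]
  have huq : (1 + skewOfUpper x).det ≠ 0 := by
    intro h
    have := (Rat.castHom ℝ).map_det (1 + skewOfUpper x)
    rw [h, map_zero, RingHom.mapMatrix_apply, hmap] at this
    exact hu this.symm
  have hR : ((1 - skewOfUpper x) * (1 + skewOfUpper x)⁻¹).map ((↑) : ℚ → ℝ) = cayley X := by
    change (Rat.castHom ℝ).mapMatrix _ = _
    have hinv : (1 + X)⁻¹ = (Rat.castHom ℝ).mapMatrix (1 + skewOfUpper x)⁻¹ := by
      apply inv_eq_right_inv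
      rw [← hmap, ← RingHom.mapMatrix_apply, ← map_mul, mul_nonsing_inv _ huq.isUnit, map_one]
    rw [cayley, hinv, map_mul, map_sub, map_one, ← hXq, RingHom.mapMatrix_apply]
  have key : ∀ N : Matrix (Fin d) (Fin d) ℝ, ((1 - X) + N * (1 + X)).det ≠ 0 →
      (cayley X + N).det ≠ 0 := by
    intro N hN h0
    refine hN ?_
    have : (1 - X) + N * (1 + X) = (cayley X + N) * (1 + X) := by
      rw [add_mul, cayley, mul_assoc, nonsing_inv_mul _ hu.isUnit, mul_one]
    rw [this, det_mul, h0, zero_mul]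
  refine ⟨(1 - skewOfUpper x) * (1 + skewOfUpper x)⁻¹, ?_, ?_, ?_⟩
  · rw [hR]; exact transpose_cayley_mul_cayley_of_skew (transpose_skewOfUpper _)
  · rw [hR]; exact key M (left_ne_zero_of_mul hx)
  · rw [hR]; exact key M' (right_ne_zero_of_mul hx)

lemma exists_eq_mul_cayley_skewOfUpper {R M : Matrix (Fin d) (Fin d) ℝ} (hR : Rᵀ * R = 1)
    (hM : Mᵀ * M = 1) (h : (R + M).det ≠ 0) : ∃ x, M = R * cayley (skewOfUpper x) := by
  have hR' : R * Rᵀ = 1 := mul_eq_one_comm.mp hR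
  have hN : (Rᵀ * M)ᵀ * (Rᵀ * M) = 1 := by
    rw [transpose_mul, transpose_transpose, mul_assoc, ← mul_assoc R, hR', one_mul, hM]
  have hdet : (1 + Rᵀ * M).det ≠ 0 := by
    have : R * (1 + Rᵀ * M) = R + M := by rw [mul_add, mul_one, ← mul_assoc, hR', one_mul]
    rw [← this, det_mul] at h
    exact right_ne_zero_of_mul h
  refine ⟨fun q => cayley (Rᵀ * M) q.1.1 q.1.2, ?_⟩
  rw [skewOfUpper_of_skew (transpose_cayley_of_orthogonal hN hdet), cayley_cayley hdet,
    ← mul_assoc, hR', one_mul]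

section LocalChart

variable {r : ℕ}

attribute [local instance] Matrix.linftyOpNormedRing Matrix.linftyOpNormedAlgebra

/-- The skew-symmetric matrix as a linear function of its upper entries in the `s`-th block. -/
noncomputable def skewCLM (s : Fin r) :
    (Fin r × {ij : Fin d × Fin d // ij.1 < ij.2} → ℝ) →L[ℝ] Matrix (Fin d) (Fin d) ℝ :=
  LinearMap.toContinuousLinearMap
    { toFun := fun x => skewOfUpper fun q => x (s, q)
      map_add' := fun x y => by
        ext i j; simp only [skewOfUpper, of_apply, Matrix.add_apply, Pi.add_apply]
        split_ifs <;> ring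
      map_smul' := fun c x => by
        ext i j; simp only [skewOfUpper, of_apply, Matrix.smul_apply, Pi.smul_apply, smul_eq_mul,
          RingHom.id_apply]
        split_ifs <;> ring }

/-- The entry functional of a matrix. -/
noncomputable def entryCLM (i j : Fin d) : Matrix (Fin d) (Fin d) ℝ →L[ℝ] ℝ :=
  LinearMap.toContinuousLinearMap (Matrix.entryLinearMap ℝ ℝ i j)

lemma hasStrictFDerivAt_cayley_upper :
    HasStrictFDerivAt
      (fun (x : Fin r × {ij : Fin d × Fin d // ij.1 < ij.2} → ℝ) q =>
        cayley (skewOfUpper fun p => x (q.1, p)) q.2.1.1 q.2.1.2)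
      ((-2 : ℝ) • ContinuousLinearMap.id ℝ _) 0 := by
  rw [hasStrictFDerivAt_pi']
  rintro ⟨s, ⟨⟨i, j⟩, hij⟩⟩
  have hcay : (fun x : Fin r × {ij : Fin d × Fin d // ij.1 < ij.2} → ℝ =>
      cayley (skewOfUpper fun p => x (s, p)) i j)
      = fun x => 2 * entryCLM i j (Ring.inverse (1 + skewCLM s x)) := by
    ext x
    have h := one_add_cayley (det_one_add_ne_zero_of_skew
      (transpose_skewOfUpper fun p => x (s, p)))
    have h' := congrFun (congrFun h i) j
    rw [Matrix.add_apply, one_apply_ne (ne_of_lt hij), zero_add] at h'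
    rw [h', nonsing_inv_eq_ringInverse]
    rfl
  change HasStrictFDerivAt (fun x : Fin r × {ij : Fin d × Fin d // ij.1 < ij.2} → ℝ =>
      cayley (skewOfUpper fun p => x (s, p)) i j) _ 0
  rw [hcay]
  have h1 : HasStrictFDerivAt
      (fun x : Fin r × {ij : Fin d × Fin d // ij.1 < ij.2} → ℝ => 1 + skewCLM (d := d) s x)
      (skewCLM s) 0 := (skewCLM s).hasStrictFDerivAt.const_add 1
  have h2 := hasStrictFDerivAt_ringInverse (𝕜 := ℝ) (1 : (Matrix (Fin d) (Fin d) ℝ)ˣ)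
  have h3 : HasStrictFDerivAt
      (fun x : Fin r × {ij : Fin d × Fin d // ij.1 < ij.2} → ℝ =>
        Ring.inverse (1 + skewCLM (d := d) s x)) _ 0 :=
    HasStrictFDerivAt.comp (0 : Fin r × {ij : Fin d × Fin d // ij.1 < ij.2} → ℝ)
      (by simpa using h2) h1
  refine (((entryCLM i j).hasStrictFDerivAt.comp _ h3).const_mul (2 : ℝ)).congr_fderiv ?_
  ext x
  change 2 * (-(1 * skewOfUpper (fun t => x (s, t)) * 1) : Matrix (Fin d) (Fin d) ℝ) i j =
      -2 * x (s, ⟨(i, j), hij⟩)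
  rw [one_mul, mul_one, Matrix.neg_apply, skewOfUpper, of_apply, dif_pos hij]
  ring

lemma eq_zero_of_aeval_cayley_upper_eq_zero
    {p : MvPolynomial (Fin r × {ij : Fin d × Fin d // ij.1 < ij.2}) ℚ}
    (hp : ∀ x : Fin r × {ij : Fin d × Fin d // ij.1 < ij.2} → ℝ, MvPolynomial.aeval
      (fun q => cayley (skewOfUpper fun t => x (q.1, t)) q.2.1.1 q.2.1.2) p = 0) : p = 0 := by
  let e : (Fin r × {ij : Fin d × Fin d // ij.1 < ij.2} → ℝ) ≃L[ℝ]
      (Fin r × {ij : Fin d × Fin d // ij.1 < ij.2} → ℝ) :=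
    ContinuousLinearEquiv.smulLeft (Units.mk0 (-2 : ℝ) (by norm_num))
  have hmap := HasStrictFDerivAt.map_nhds_eq_of_equiv (f' := e)
    (hasStrictFDerivAt_cayley_upper (d := d) (r := r))
  obtain ⟨y₀, hev⟩ : ∃ y₀ : Fin r × {ij : Fin d × Fin d // ij.1 < ij.2} → ℝ,
      ∀ᶠ y in nhds y₀, MvPolynomial.aeval y p = 0 :=
    ⟨_, by rw [← hmap, Filter.eventually_map]; exact Filter.Eventually.of_forall hp⟩
  obtain ⟨ε, hε, hball⟩ := Metric.eventually_nhds_iff_ball.mp hev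
  apply MvPolynomial.map_injective (algebraMap ℚ ℝ) (algebraMap ℚ ℝ).injective
  rw [map_zero]
  refine MvPolynomial.funext_set (fun q => Metric.ball (y₀ q) ε)
    (fun q => infinite_of_mem_nhds _ (Metric.ball_mem_nhds _ hε)) fun y hy => ?_
  rw [← ball_pi _ hε] at hy
  rw [map_zero, MvPolynomial.eval_map, ← MvPolynomial.aeval_def]
  exact hball y hy

end LocalChart

end Skew

/-- A tuple in `SO(d)^r` is generic iff its entries strictly above the diagonals are
algebraically independent over `ℚ`. -/
theorem generic_iff_upper_entries_algebraically_independent (d r : ℕ)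
    (hd : 2 ≤ d) (hr : 1 ≤ r)
    (γ : Fin r → Matrix (Fin d) (Fin d) ℝ) (hγ : ∀ s, γ s ∈ SOSet d) :
    IsGeneric γ ↔
      AlgebraicIndependent ℚ
        (fun q : Fin r × {ij : Fin d × Fin d // ij.1 < ij.2} =>
          γ q.1 q.2.1.1 q.2.1.2) := by
  constructor
  · intro hgen
    rw [algebraicIndependent_iff]
    intro p hp
    refine eq_zero_of_aeval_cayley_upper_eq_zero fun x => ?_
    have := hgen (MvPolynomial.rename (fun q => (q.1, q.2.1.1, q.2.1.2)) p)
      (by rw [MvPolynomial.aeval_rename]; exact hp)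
      (fun s => cayley (skewOfUpper fun t => x (s, t)))
      (fun s => cayley_skewOfUpper_mem_SOSet _)
    rwa [MvPolynomial.aeval_rename] at this
  · intro hind p hp β hβ
    choose R hR hRγ hRβ using fun s => exists_rational_rotation (hγ s) (hβ s)
    choose a ha using fun s => exists_eq_mul_cayley_skewOfUpper (hR s) (hγ s).1 (hRγ s)
    choose b hb using fun s => exists_eq_mul_cayley_skewOfUpper (hR s) (hβ s).1 (hRβ s)
    let Φ : Fin r × Fin d × Fin d →
        (Fin r × {ij : Fin d × Fin d // ij.1 < ij.2} → ℝ) → ℝ := fun q x =>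
      ((R q.1).map ((↑) : ℚ → ℝ) * cayley (skewOfUpper fun t => x (q.1, t))) q.2.1 q.2.2
    have hΦ : ∀ q, Φ q ∈ regularFunctions _ := fun q =>
      regularFunctions.mul_matrix_mem
        (fun i j => regularFunctions.const_mem (R q.1 i j))
        (regularFunctions.cayley_mem
          (fun i j => regularFunctions.skewOfUpper_mem q.1 i j)
          (fun x => det_one_add_ne_zero_of_skew (transpose_skewOfUpper _))) _ _
    have hΦγ : ∀ q, Φ q (fun t => a t.1 t.2) = γ q.1 q.2.1 q.2.2 := fun q => by
      rw [ha q.1]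
    have hΦβ : ∀ q, Φ q (fun t => b t.1 t.2) = β q.1 q.2.1 q.2.2 := fun q => by
      rw [hb q.1]
    have haind : AlgebraicIndependent ℚ
        (fun t : Fin r × {ij : Fin d × Fin d // ij.1 < ij.2} => a t.1 t.2) :=
      algebraicIndependent_of_regularFunctions
        (g := fun q => Φ (q.1, q.2.1.1, q.2.1.2)) (fun q => hΦ _) (by simpa only [hΦγ] using hind)
    have := eq_zero_of_mem_regularFunctions haind (regularFunctions.aeval_mem hΦ p)
      (by simpa only [hΦγ] using hp) (fun t => b t.1 t.2)
    simpa only [hΦβ] using this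
end

section
/- Let t₁, t₂ ∈ 𝕋. There exists a Borel subset A ⊆ 𝕋 such that the translates t₁ + A and t₂ + A partition 𝕋 if and only if there exists an integer n ≥ 1 such that n·(t₁ − t₂) = π in 𝕋 (equivalently, t₁ − t₂ generates a finite cyclic subgroup of 𝕋 of even order). -/
open Real

section Translates

open Set

/-- The translates of `A` by `t₁` and `t₂` partition an additive group iff translation by
`t₁ - t₂` exchanges `A` and its complement. -/
theorem disjoint_translates_and_union_eq_univ_iff {G : Type*} [AddCommGroup G] (t₁ t₂ : G)
    (A : Set G) :
    (Disjoint ((t₁ + ·) '' A) ((t₂ + ·) '' A) ∧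
      ((t₁ + ·) '' A) ∪ ((t₂ + ·) '' A) = univ) ↔ ∀ y, y + (t₁ - t₂) ∈ A ↔ y ∉ A := by
  have h₁ (t x : G) : x ∈ (t + ·) '' A ↔ x - t ∈ A := by
    simp [image_add_left, sub_eq_neg_add]
  simp only [Set.disjoint_left, Set.ext_iff, mem_union, mem_univ, iff_true, h₁]
  constructor
  · rintro ⟨hd, hu⟩ y
    have hd := @hd (y + t₁)
    have hu := hu (y + t₁)
    rw [add_sub_cancel_right, add_sub_assoc] at hd hu
    tauto
  · intro h
    have key (x : G) : x - t₂ ∈ A ↔ x - t₁ ∉ A := by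
      rw [← h, sub_add_sub_cancel]
    constructor
    · intro x hx
      rw [key]
      tauto
    · intro x
      rw [key]
      tauto

/-- Iterating a translation that exchanges `A` and its complement. -/
theorem add_nsmul_mem_iff_of_exchange {G : Type*} [AddCommGroup G] {s : G} {A : Set G}
    (h : ∀ y, y + s ∈ A ↔ y ∉ A) (n : ℕ) (y : G) :
    y + n • s ∈ A ↔ (y ∈ A ↔ Even n) := by
  induction n with
  | zero => simp
  | succ n ih =>
    rw [succ_nsmul, ← add_assoc, h, ih, Nat.even_add_one]
    tauto

end Translates

namespace AddCircle

open Set MeasureTheory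

/-- A translation of the circle exchanging a measurable set and its complement has finite order. -/
theorem isOfFinAddOrder_of_exchange {p : ℝ} [Fact (0 < p)] {s : AddCircle p}
    {A : Set (AddCircle p)} (hA : MeasurableSet A) (h : ∀ y, y + s ∈ A ↔ y ∉ A) :
    IsOfFinAddOrder s := by
  by_contra hs
  have herg : Ergodic (fun y : AddCircle p ↦ y + 2 • s) := by
    rw [ergodic_add_right, addOrderOf_eq_zero_iff, isOfFinAddOrder_nsmul]
    simpa using hs
  have hcompl : volume Aᶜ = volume A := by
    rw [← measure_preimage_add_right volume s A]
    congr 1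
    ext y
    exact (h y).symm
  have hzero : volume A = 0 := by
    have hinv : (fun y : AddCircle p ↦ y + 2 • s) ⁻¹' A = A := by
      ext y
      simpa using add_nsmul_mem_iff_of_exchange h 2 y
    rcases herg.measure_self_or_compl_eq_zero hA hinv with h0 | h0
    · exact h0
    · rwa [hcompl] at h0
  have huniv : volume (univ : Set (AddCircle p)) = 0 := by
    rw [← measure_add_measure_compl hA, hcompl, hzero, add_zero]
  exact NeZero.ne _ (Measure.measure_univ_eq_zero.mp huniv)

/-- Translation by `π` exchanges a half-open half circle and its complement. -/
theorem equivIco_add_pi_lt_pi_iff [Fact (0 < 2 * π)] (z : AddCircle (2 * π)) :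
    (equivIco (2 * π) 0 (z + (π : ℝ)) : ℝ) < π ↔ ¬ (equivIco (2 * π) 0 z : ℝ) < π := by
  have hπ := Real.pi_pos
  obtain ⟨⟨r, hr0, hr⟩, rfl⟩ := (equivIco (2 * π) 0).symm.surjective z
  rw [Equiv.apply_symm_apply]
  change (equivIco (2 * π) 0 ((r : AddCircle (2 * π)) + (π : ℝ)) : ℝ) < π ↔ ¬ r < π
  rcases lt_or_ge r π with hlt | hle
  · rw [← coe_add, equivIco_coe_of_mem (by constructor <;> linarith)]
    constructor <;> intro <;> linarith
  · have hrot : (r : AddCircle (2 * π)) + (π : ℝ) = ((r - π : ℝ) : AddCircle (2 * π)) := by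
      rw [← coe_add, ← coe_add_period (2 * π) (r - π)]
      congr 1
      ring
    rw [hrot, equivIco_coe_of_mem (by constructor <;> linarith)]
    constructor <;> intro <;> linarith

end AddCircle

/-- The circle `𝕋 = ℝ/2πℤ` is Borel-divisible into the two translates `t₁ + A, t₂ + A`
iff some positive multiple of `t₁ - t₂` equals `π` in `𝕋` (equivalently, `t₁ - t₂`
generates a finite cyclic subgroup of even order). -/
theorem borel_two_divisibility_circle (t₁ t₂ : AddCircle (2 * π)) :
    (∃ A : Set (AddCircle (2 * π)), MeasurableSet A ∧
      Disjoint ((t₁ + ·) '' A) ((t₂ + ·) '' A) ∧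
      ((t₁ + ·) '' A) ∪ ((t₂ + ·) '' A) = Set.univ) ↔
    (∃ n : ℕ, 1 ≤ n ∧ n • (t₁ - t₂) = ((π : ℝ) : AddCircle (2 * π))) := by
  have : Fact (0 < 2 * π) := ⟨Real.two_pi_pos⟩
  simp only [disjoint_translates_and_union_eq_univ_iff]
  generalize t₁ - t₂ = s
  constructor
  · rintro ⟨A, hA, h⟩
    have hpos : 0 < addOrderOf s := (AddCircle.isOfFinAddOrder_of_exchange hA h).addOrderOf_pos
    have heven : Even (addOrderOf s) := by
      have := add_nsmul_mem_iff_of_exchange h (addOrderOf s) 0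
      rw [addOrderOf_nsmul_eq_zero, add_zero] at this
      tauto
    obtain ⟨k, hk⟩ := heven
    have hk_ne : k • s ≠ 0 := nsmul_ne_zero_of_lt_addOrderOf (by lia) (by lia)
    have htwo : 2 • (k • s) = 0 := by
      rw [two_nsmul, ← add_nsmul, ← hk, addOrderOf_nsmul_eq_zero]
    exact ⟨k, by lia, (Real.Angle.two_nsmul_eq_zero_iff.mp htwo).resolve_left hk_ne⟩
  · rintro ⟨n, -, hn⟩
    refine ⟨{y | (AddCircle.equivIco (2 * π) 0 (n • y) : ℝ) < π}, ?_, fun y ↦ ?_⟩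
    · have hmeas : Measurable fun y : AddCircle (2 * π) ↦
          (AddCircle.measurableEquivIco (2 * π) 0 (n • y) : ℝ) :=
        measurable_subtype_coe.comp ((AddCircle.measurableEquivIco (2 * π) 0).measurable.comp
          (continuous_nsmul n).measurable)
      exact measurableSet_lt hmeas measurable_const
    · simpa only [Set.mem_ofPred_eq, nsmul_add, hn] using
        AddCircle.equivIco_add_pi_lt_pi_iff (n • y)
end

section
/- Let t₁, t₂, t₃ ∈ 𝕋. There exists a Borel subset A ⊆ 𝕋 such that the translates t₁ + A, t₂ + A, t₃ + A partition 𝕋 if and only if there exists an integer n ≥ 1 with cos(n t₁) + cos(n t₂) + cos(n t₃) = 0 and sin(n t₁) + sin(n t₂) + sin(n t₃) = 0. -/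
open Real MeasureTheory

section Translates

variable {T : ℝ} {ι : Type*} [Fintype ι]

theorem sum_indicator_sub_eq_one_of_partition (s : ι → AddCircle T) {A : Set (AddCircle T)}
    (hd : Pairwise fun i j => Disjoint ((s i + ·) '' A) ((s j + ·) '' A))
    (hu : (⋃ i, (s i + ·) '' A) = Set.univ) (x : AddCircle T) :
    ∑ i, A.indicator (1 : AddCircle T → ℂ) (x - s i) = 1 := by
  have hmem : ∀ i, x ∈ (s i + ·) '' A ↔ x - s i ∈ A := fun i => by
    simp [Set.image_add_left, sub_eq_neg_add]
  obtain ⟨i, hi⟩ := Set.mem_iUnion.1 (hu.ge (Set.mem_univ x))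
  rw [Finset.sum_eq_single i, Set.indicator_of_mem ((hmem i).1 hi), Pi.one_apply]
  · intro j _ hj
    exact Set.indicator_of_notMem
      (fun h => Set.disjoint_left.1 (hd hj) ((hmem j).2 h) hi) _
  · simp

variable [hT : Fact (0 < T)]

theorem fourierCoeff_comp_sub_right (f : AddCircle T → ℂ) (s : AddCircle T) (n : ℤ) :
    fourierCoeff (fun x => f (x - s)) n = fourier (-n) s * fourierCoeff f n := by
  have h := integral_sub_right_eq_self (μ := AddCircle.haarAddCircle)
    (fun t => fourier (-n) (t + s) • f t) s
  simp only [sub_add_cancel] at h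
  rw [fourierCoeff, h, fourierCoeff, ← integral_const_mul]
  congr 1 with t
  simp only [fourier_apply, smul_add, AddCircle.toCircle_add, Circle.coe_mul, smul_eq_mul]
  ring

theorem fourierCoeff_one (n : ℤ) :
    fourierCoeff (1 : AddCircle T → ℂ) n = if n = 0 then 1 else 0 := by
  have h : (1 : AddCircle T → ℂ) = fourier 0 := by
    ext x
    simp
  rw [h, fourierCoeff_fourier, Pi.single_apply]

theorem tsum_sq_fourierCoeff_indicator_one {A : Set (AddCircle T)} (hA : MeasurableSet A) :
    ∑' n : ℤ, ‖fourierCoeff (A.indicator (1 : AddCircle T → ℂ)) n‖ ^ 2 =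
      AddCircle.haarAddCircle.real A := by
  have hf : MemLp (A.indicator (1 : AddCircle T → ℂ)) 2 AddCircle.haarAddCircle :=
    (memLp_const (1 : ℂ)).indicator hA
  have h := tsum_sq_fourierCoeff hf.toLp
  rw [fourierCoeff_congr_ae hf.coeFn_toLp] at h
  rw [h, ← integral_indicator_one hA]
  refine integral_congr_ae ?_
  filter_upwards [hf.coeFn_toLp] with x hx
  rw [hx]
  by_cases hxA : x ∈ A <;> simp [hxA]

theorem fourierCoeff_indicator_one_zero {A : Set (AddCircle T)} (hA : MeasurableSet A) :
    fourierCoeff (A.indicator (1 : AddCircle T → ℂ)) 0 = AddCircle.haarAddCircle.real A := by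
  have h : ∫ x, A.indicator (1 : AddCircle T → ℂ) x ∂AddCircle.haarAddCircle =
      AddCircle.haarAddCircle.real A := by
    rw [integral_indicator hA]
    simp
  simp [fourierCoeff, h]

/-- If the circle is partitioned by at least two translates of a Borel set, then some nontrivial
character sums to zero over the translations. -/
theorem exists_sum_fourier_eq_zero_of_partition (hι : 1 < Fintype.card ι) (s : ι → AddCircle T)
    {A : Set (AddCircle T)} (hA : MeasurableSet A)
    (hd : Pairwise fun i j => Disjoint ((s i + ·) '' A) ((s j + ·) '' A))
    (hu : (⋃ i, (s i + ·) '' A) = Set.univ) :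
    ∃ n : ℕ, 1 ≤ n ∧ ∑ i, fourier (n : ℤ) (s i) = 0 := by
  set f : AddCircle T → ℂ := A.indicator 1 with hf
  have hfi : Integrable f AddCircle.haarAddCircle := (integrable_const (1 : ℂ)).indicator hA
  have key : ∀ n : ℤ, (∑ i, fourier (-n) (s i)) * fourierCoeff f n = if n = 0 then 1 else 0 := by
    intro n
    have h1 : (∑ i, fun x => f (x - s i)) = 1 := by
      ext x
      simpa using sum_indicator_sub_eq_one_of_partition s hd hu x
    rw [← fourierCoeff_one (T := T), ← h1, fourierCoeff.sum _ _ fun i _ => hfi.comp_sub_right (s i),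
      Finset.sum_apply, Finset.sum_mul]
    simp only [fourierCoeff_comp_sub_right]
  by_contra! hne
  have hne' : ∀ n : ℤ, n ≠ 0 → ∑ i, fourier (-n) (s i) ≠ 0 := by
    intro n hn h0
    rcases Int.natAbs_eq n with h | h
    · refine hne n.natAbs (by lia) ?_
      rw [← h, ← map_eq_zero (starRingEnd ℂ), map_sum]
      simpa only [← fourier_neg] using h0
    · refine hne n.natAbs (by lia) ?_
      rwa [show (n.natAbs : ℤ) = -n by lia]
  have hz : ∀ n : ℤ, n ≠ 0 → fourierCoeff f n = 0 := fun n hn =>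
    (mul_eq_zero.1 ((key n).trans (if_neg hn))).resolve_left (hne' n hn)
  have hP := tsum_sq_fourierCoeff_indicator_one hA
  have h0 := key 0
  rw [tsum_eq_single 0 fun n hn => by rw [← hf, hz n hn]; simp,
    fourierCoeff_indicator_one_zero hA, Complex.norm_real, norm_eq_abs, sq_abs] at hP
  rw [hf, fourierCoeff_indicator_one_zero hA] at h0
  have h0' : (Fintype.card ι : ℝ) * AddCircle.haarAddCircle.real A = 1 := by
    have : (Fintype.card ι : ℂ) * (AddCircle.haarAddCircle.real A : ℂ) = 1 := by
      simpa using h0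
    exact_mod_cast this
  have hι' : (1 : ℝ) < Fintype.card ι := by exact_mod_cast hι
  have hm : AddCircle.haarAddCircle.real A ≠ 0 := right_ne_zero_of_mul_eq_one h0'
  have hm1 : AddCircle.haarAddCircle.real A = 1 := mul_right_cancel₀ hm (by linarith)
  rw [hm1] at h0'
  linarith

/-- If multiplication by `n` carries `s` to a coset of a subgroup of order three, then the circle
is partitioned by three translates of a Borel set. -/
theorem exists_partition_of_nsmul_sub_eq (s : Fin 3 → AddCircle T) (n : ℕ) {d : AddCircle T}
    (hd : d ≠ 0) (h01 : n • s 1 - n • s 0 = d) (h12 : n • s 2 - n • s 1 = d)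
    (h20 : n • s 0 - n • s 2 = d) :
    ∃ A : Set (AddCircle T), MeasurableSet A ∧
      (Pairwise fun i j => Disjoint ((s i + ·) '' A) ((s j + ·) '' A)) ∧
      (⋃ i, (s i + ·) '' A) = Set.univ := by
  let r : AddCircle T → ℝ := fun x => AddCircle.measurableEquivIco T 0 x
  have hr : Measurable r := measurable_subtype_coe.comp (AddCircle.measurableEquivIco T 0).measurable
  have hri : Function.Injective r :=
    Subtype.val_injective.comp (AddCircle.measurableEquivIco T 0).injective
  let A : Set (AddCircle T) := {x | r (n • x) < r (n • x - d) ∧ r (n • x) < r (n • x + d)}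
  have hA : MeasurableSet A :=
    (measurableSet_lt (f := fun x => r (n • x)) (g := fun x => r (n • x - d))
      (by fun_prop) (by fun_prop)).inter
    (measurableSet_lt (f := fun x => r (n • x)) (g := fun x => r (n • x + d))
      (by fun_prop) (by fun_prop))
  have hmem : ∀ i x, x ∈ (s i + ·) '' A ↔
      r (n • x - n • s i) < r (n • x - n • s i - d) ∧
      r (n • x - n • s i) < r (n • x - n • s i + d) := fun i x => by
    simp [Set.image_add_left, A, ← sub_eq_neg_add, smul_sub]
  have h0 : ∀ x, x ∈ (s 0 + ·) '' A ↔ r (n • x - n • s 0) < r (n • x - n • s 1) ∧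
      r (n • x - n • s 0) < r (n • x - n • s 2) := fun x => by
    rw [hmem]; nth_rw 1 [← h01]; rw [← h20]; simp
  have h1 : ∀ x, x ∈ (s 1 + ·) '' A ↔ r (n • x - n • s 1) < r (n • x - n • s 2) ∧
      r (n • x - n • s 1) < r (n • x - n • s 0) := fun x => by
    rw [hmem]; nth_rw 1 [← h12]; rw [← h01]; simp
  have h2 : ∀ x, x ∈ (s 2 + ·) '' A ↔ r (n • x - n • s 2) < r (n • x - n • s 0) ∧
      r (n • x - n • s 2) < r (n • x - n • s 1) := fun x => by
    rw [hmem]; nth_rw 1 [← h20]; rw [← h12]; simp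
  refine ⟨A, hA, ?_, ?_⟩
  · intro i j hij
    rw [Set.disjoint_left]
    intro x hi hj
    fin_cases i <;> fin_cases j <;> simp only [Fin.zero_eta, Fin.mk_one, Fin.reduceFinMk, ne_eq,
      not_true_eq_false, h0, h1, h2] at hi hj hij <;> linarith [hi.1, hi.2, hj.1, hj.2]
  · refine Set.eq_univ_of_forall fun x => ?_
    have hne : ∀ {i j}, n • s i - n • s j = d → r (n • x - n • s i) ≠ r (n • x - n • s j) :=
      fun h h' => hd (by rw [← h, sub_right_inj.1 (hri h'), sub_self])
    have n01 := hne h01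
    have n12 := hne h12
    have n20 := hne h20
    simp only [Set.mem_iUnion, Fin.exists_fin_succ, Fin.succ_zero_eq_one, Fin.succ_one_eq_two,
      IsEmpty.exists_iff, or_false, h0, h1, h2]
    grind

end Translates

/-- Three angles whose unit vectors sum to zero have consecutive differences of cosine `-1/2`,
and the sines of these differences agree. -/
theorem cos_sub_sin_sub_of_sum_eq_zero {a b c : ℝ} (hc : cos a + cos b + cos c = 0)
    (hs : sin a + sin b + sin c = 0) :
    cos (b - a) = -1 / 2 ∧ sin (c - b) = sin (b - a) := by
  have hc' : cos c = -cos a - cos b := by linarith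
  have hs' : sin c = -sin a - sin b := by linarith
  have h := sin_sq_add_cos_sq c
  rw [hc', hs'] at h
  rw [cos_sub, sin_sub, sin_sub, hc', hs']
  constructor
  · linear_combination (h - sin_sq_add_cos_sq a - sin_sq_add_cos_sq b) / 2
  · ring

/-- The circle `𝕋 = ℝ/2πℤ` is Borel-divisible into the three translates
`t₁ + A, t₂ + A, t₃ + A` iff for some `n ≥ 1` the unit vectors `(cos (n tᵢ), sin (n tᵢ))`,
`i = 1, 2, 3`, sum to zero. -/
theorem borel_three_divisibility_circle (t₁ t₂ t₃ : ℝ) :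
    (∃ A : Set (AddCircle (2 * π)), MeasurableSet A ∧
      (Pairwise fun i j => Disjoint
        ((((![t₁, t₂, t₃] i : ℝ) : AddCircle (2 * π)) + ·) '' A)
        ((((![t₁, t₂, t₃] j : ℝ) : AddCircle (2 * π)) + ·) '' A)) ∧
      (⋃ i : Fin 3, (((![t₁, t₂, t₃] i : ℝ) : AddCircle (2 * π)) + ·) '' A) = Set.univ) ↔
    (∃ n : ℕ, 1 ≤ n ∧ cos (n * t₁) + cos (n * t₂) + cos (n * t₃) = 0 ∧
      sin (n * t₁) + sin (n * t₂) + sin (n * t₃) = 0) := by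
  have : Fact (0 < 2 * π) := ⟨two_pi_pos⟩
  constructor
  · rintro ⟨A, hA, hd, hu⟩
    obtain ⟨n, hn, h⟩ := exists_sum_fourier_eq_zero_of_partition (by simp)
      (fun i => ((![t₁, t₂, t₃] i : ℝ) : AddCircle (2 * π))) hA hd hu
    have hexp : ∀ t : ℝ, fourier (n : ℤ) (t : AddCircle (2 * π)) =
        Complex.exp ((n * t : ℝ) * Complex.I) := fun t => by
      rw [fourier_coe_apply]
      congr 1
      have : (π : ℂ) ≠ 0 := by exact_mod_cast pi_ne_zero
      push_cast
      field_simp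
    simp only [Fin.sum_univ_three, hexp] at h
    refine ⟨n, hn, ?_, ?_⟩
    · simpa only [Complex.add_re, Complex.exp_ofReal_mul_I_re, Complex.zero_re,
        Matrix.cons_val] using congrArg Complex.re h
    · simpa only [Complex.add_im, Complex.exp_ofReal_mul_I_im, Complex.zero_im,
        Matrix.cons_val] using congrArg Complex.im h
  · rintro ⟨n, -, hc, hs⟩
    obtain ⟨c01, s01⟩ := cos_sub_sin_sub_of_sum_eq_zero hc hs
    obtain ⟨c12, s12⟩ := cos_sub_sin_sub_of_sum_eq_zero (a := n * t₂) (b := n * t₃) (c := n * t₁)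
      (by linarith) (by linarith)
    obtain ⟨c20, -⟩ := cos_sub_sin_sub_of_sum_eq_zero (a := n * t₃) (b := n * t₁) (c := n * t₂)
      (by linarith) (by linarith)
    have hcoe : ∀ x y : ℝ, n • (x : AddCircle (2 * π)) - n • (y : AddCircle (2 * π)) =
        ((n * x - n * y : ℝ) : AddCircle (2 * π)) := fun x y => by
      rw [AddCircle.coe_sub, ← nsmul_eq_mul, ← nsmul_eq_mul, AddCircle.coe_nsmul, AddCircle.coe_nsmul]
    refine exists_partition_of_nsmul_sub_eq (fun i => ((![t₁, t₂, t₃] i : ℝ) : AddCircle (2 * π)))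
      n (d := ((n * t₂ - n * t₁ : ℝ) : AddCircle (2 * π))) ?_ (hcoe _ _) ?_ ?_
    · intro h
      have := congrArg Real.Angle.cos (show ((n * t₂ - n * t₁ : ℝ) : Real.Angle) = (0 : ℝ) from h)
      rw [Real.Angle.cos_coe, Real.Angle.cos_coe, c01, cos_zero] at this
      norm_num at this
    · exact (hcoe _ _).trans (Real.Angle.cos_sin_inj (c12.trans c01.symm) s01)
    · exact (hcoe _ _).trans (Real.Angle.cos_sin_inj (c20.trans c01.symm) (s12.trans s01))
end

section
/- Let a ∈ ℝ be such that a/π is irrational, and write ā for the image of a in 𝕋 and π̄ for the image of π in 𝕋. Then there is no Lebesgue-measurable subset A ⊆ 𝕋 such that the four translates ā + A, ā + π̄ + A, π̄ + A, and A are pairwise disjoint and the complement of their union has measure zero. -/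
open MeasureTheory Real

instance : Fact ((0 : ℝ) < 2 * π) := ⟨by positivity⟩

/-- If the square of a map is ergodic, then the map cannot exchange a measurable set with its
complement up to a null set. -/
theorem QuasiErgodic.not_ae_mem_iff_notMem {X : Type*} [MeasurableSpace X] {μ : Measure X}
    [NeZero μ] {f : X → X} (hff : QuasiErgodic (f ∘ f) μ)
    (hf : Measure.QuasiMeasurePreserving f μ μ) {B : Set X} (hB : NullMeasurableSet B μ) :
    ¬ ∀ᵐ x ∂μ, f x ∈ B ↔ x ∉ B := by
  intro h
  have hinv : (f ∘ f) ⁻¹' B =ᵐ[μ] B := by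
    rw [Filter.eventuallyEq_set]
    filter_upwards [h, hf.ae h] with x h1 h2
    simp only [Set.mem_preimage, Function.comp_apply]
    tauto
  have hfalse : ∀ᵐ _ ∂μ, False := by
    rcases hff.ae_empty_or_univ₀ hB hinv with h0 | h0
    · have h1 : ∀ᵐ x ∂μ, x ∉ B := by
        filter_upwards [h0.mem_iff] with x hx using by simp [hx]
      filter_upwards [h, h1, hf.ae h1] with x hx h2 h3 using h3 (hx.2 h2)
    · have h1 : ∀ᵐ x ∂μ, x ∈ B := by
        filter_upwards [h0.mem_iff] with x hx using by simp [hx]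
      filter_upwards [h, h1, hf.ae h1] with x hx h2 h3 using hx.1 h3 h2
  exact hfalse.exists.choose_spec

/-- A real number incommensurable with the period has infinite order in the circle. -/
theorem AddCircle.addOrderOf_coe_eq_zero_of_irrational {p : ℝ} {x : ℝ}
    (hx : Irrational (x / p)) : addOrderOf (x : AddCircle p) = 0 := by
  rw [addOrderOf_eq_zero_iff']
  intro n hn h
  rw [← AddCircle.coe_nsmul, AddCircle.coe_eq_zero_iff] at h
  obtain ⟨m, hm⟩ := h
  have hp : p ≠ 0 := by
    rintro rfl
    simp at hx
  have hn' : (n : ℝ) ≠ 0 := by positivity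
  refine hx ⟨m / n, ?_⟩
  simp only [zsmul_eq_mul, nsmul_eq_mul] at hm
  push_cast
  field_simp
  linarith

/-- If `a/π` is irrational, then there is no Lebesgue-measurable `A ⊆ 𝕋` whose translates
by `a`, `a + π`, `π` and `0` are pairwise disjoint and cover `𝕋` up to a null set. -/
theorem no_measurable_division_irrational (a : ℝ) (ha : Irrational (a / π)) :
    ¬ ∃ A : Set (AddCircle (2 * π)), NullMeasurableSet A volume ∧
      (Pairwise fun i j : Fin 4 => Disjoint
        ((((![a, a + π, π, 0] i : ℝ) : AddCircle (2 * π)) + ·) '' A)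
        ((((![a, a + π, π, 0] j : ℝ) : AddCircle (2 * π)) + ·) '' A)) ∧
      volume (Set.univ \
        ⋃ i : Fin 4, (((![a, a + π, π, 0] i : ℝ) : AddCircle (2 * π)) + ·) '' A) = 0 := by
  rintro ⟨A, hA, hdisj, hcover⟩
  have hmp (t : AddCircle (2 * π)) : MeasurePreserving (t + ·) volume volume :=
    measurePreserving_add_left volume t
  have hord : addOrderOf ((a + a : ℝ) : AddCircle (2 * π)) = 0 := by
    refine AddCircle.addOrderOf_coe_eq_zero_of_irrational ?_
    rwa [← two_mul, mul_div_mul_left _ _ two_ne_zero]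
  have herg : QuasiErgodic (((a : AddCircle (2 * π)) + ·) ∘ ((a : AddCircle (2 * π)) + ·))
      volume := by
    have h := (AddCircle.ergodic_add_left.2 hord).quasiErgodic
    convert h using 1
    ext x
    simp [add_assoc]
  have hcover' : ∀ᵐ x : AddCircle (2 * π), ∃ i : Fin 4,
      -((![a, a + π, π, 0] i : ℝ) : AddCircle (2 * π)) + x ∈ A := by
    rw [ae_iff]
    convert hcover using 2
    ext x
    simp only [Set.image_add_left, Set.mem_sdiff, Set.mem_iUnion, Set.mem_preimage,
      Set.mem_univ, true_and, Set.mem_ofPred_eq]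
  refine QuasiErgodic.not_ae_mem_iff_notMem herg (hmp a).quasiMeasurePreserving
    (B := {x | -((π : ℝ) : AddCircle (2 * π)) + x ∈ A} ∪ A)
    ((hA.preimage (hmp _).quasiMeasurePreserving).union hA) ?_
  have hd (i j : Fin 4) (hij : i ≠ j) (x : AddCircle (2 * π))
      (hi : -((![a, a + π, π, 0] i : ℝ) : AddCircle (2 * π)) + x ∈ A)
      (hj : -((![a, a + π, π, 0] j : ℝ) : AddCircle (2 * π)) + x ∈ A) : False := by
    have h := hdisj hij
    simp only [Set.image_add_left] at h
    exact Set.disjoint_left.1 h hi hj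
  filter_upwards [(hmp a).quasiMeasurePreserving.ae hcover'] with x hx
  have h02 := hd 0 2 (by decide) ((a : AddCircle (2 * π)) + x)
  have h03 := hd 0 3 (by decide) ((a : AddCircle (2 * π)) + x)
  have h12 := hd 1 2 (by decide) ((a : AddCircle (2 * π)) + x)
  have h13 := hd 1 3 (by decide) ((a : AddCircle (2 * π)) + x)
  simp only [Fin.exists_fin_succ, Fin.exists_fin_zero] at hx
  simp at hx h02 h03 h12 h13
  simp only [Set.mem_union, Set.mem_ofPred_eq]
  tauto
end

section
/- Four unit vectors v₁, v₂, v₃, v₄ ∈ S¹ ⊆ ℝ² satisfy v₁ + v₂ + v₃ + v₄ = 0 if and only if they can be split into two pairs of opposite vectors, i.e. there is a permutation σ of {1,2,3,4} with v_{σ(1)} = −v_{σ(2)} and v_{σ(3)} = −v_{σ(4)}. -/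
/-- Unit vectors in the plane whose inner product is `-1` are opposite. -/
theorem eq_neg_of_inner_eq_neg_one {a b : ℝ × ℝ} (ha : a.1 ^ 2 + a.2 ^ 2 = 1)
    (hb : b.1 ^ 2 + b.2 ^ 2 = 1) (h : 1 + (a.1 * b.1 + a.2 * b.2) = 0) : a = -b := by
  have hsq : (a.1 + b.1) ^ 2 + (a.2 + b.2) ^ 2 = 0 := by linear_combination ha + hb + 2 * h
  ext
  · have : a.1 + b.1 = 0 := by nlinarith [sq_nonneg (a.1 + b.1), sq_nonneg (a.2 + b.2)]
    simpa using eq_neg_of_add_eq_zero_left this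
  · have : a.2 + b.2 = 0 := by nlinarith [sq_nonneg (a.1 + b.1), sq_nonneg (a.2 + b.2)]
    simpa using eq_neg_of_add_eq_zero_left this

/-- If the sum of three unit vectors in the plane is a unit vector, then two of the three
are opposite. -/
theorem exists_eq_neg_of_add_add_unit {a b c : ℝ × ℝ} (ha : a.1 ^ 2 + a.2 ^ 2 = 1)
    (hb : b.1 ^ 2 + b.2 ^ 2 = 1) (hc : c.1 ^ 2 + c.2 ^ 2 = 1)
    (h : (a.1 + b.1 + c.1) ^ 2 + (a.2 + b.2 + c.2) ^ 2 = 1) :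
    a = -b ∨ b = -c ∨ a = -c := by
  obtain ⟨x, hx⟩ : ∃ x, x = a.1 * b.1 + a.2 * b.2 := ⟨_, rfl⟩
  obtain ⟨y, hy⟩ : ∃ y, y = b.1 * c.1 + b.2 * c.2 := ⟨_, rfl⟩
  obtain ⟨z, hz⟩ : ∃ z, z = a.1 * c.1 + a.2 * c.2 := ⟨_, rfl⟩
  have hsum : x + y + z = -1 := by
    rw [hx, hy, hz]
    linear_combination (h - ha - hb - hc) / 2
  -- The Gram determinant of three vectors in the plane vanishes.
  have hgram : 1 + 2 * x * y * z - x ^ 2 - y ^ 2 - z ^ 2 = 0 := by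
    have key : (a.1 ^ 2 + a.2 ^ 2) * (b.1 ^ 2 + b.2 ^ 2) * (c.1 ^ 2 + c.2 ^ 2)
        + 2 * x * y * z - (c.1 ^ 2 + c.2 ^ 2) * x ^ 2 - (a.1 ^ 2 + a.2 ^ 2) * y ^ 2
        - (b.1 ^ 2 + b.2 ^ 2) * z ^ 2 = 0 := by
      rw [hx, hy, hz]
      ring
    rw [ha, hb, hc] at key
    linear_combination key
  have hprod : (1 + x) * (1 + y) * (1 + z) = 0 := by
    linear_combination hgram / 2 + (x + y + z + 1) / 2 * hsum
  rcases mul_eq_zero.mp hprod with hxy | hz0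
  · rcases mul_eq_zero.mp hxy with hx0 | hy0
    · exact .inl (eq_neg_of_inner_eq_neg_one ha hb (hx ▸ hx0))
    · exact .inr (.inl (eq_neg_of_inner_eq_neg_one hb hc (hy ▸ hy0)))
  · exact .inr (.inr (eq_neg_of_inner_eq_neg_one ha hc (hz ▸ hz0)))

/-- Four unit vectors in `ℝ²` sum to zero iff they can be split into two pairs of
opposite vectors. -/
theorem four_unit_vectors_sum_zero_iff (v : Fin 4 → ℝ × ℝ)
    (hv : ∀ i, (v i).1 ^ 2 + (v i).2 ^ 2 = 1) :
    (∑ i, v i = 0) ↔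
      ∃ σ : Equiv.Perm (Fin 4), v (σ 0) = -v (σ 1) ∧ v (σ 2) = -v (σ 3) := by
  have split (σ : Equiv.Perm (Fin 4)) (h : v (σ 0) = -v (σ 1)) :
      ∑ i, v i = 0 ↔ v (σ 2) = -v (σ 3) := by
    rw [← Equiv.sum_comp σ v, Fin.sum_univ_four, h, neg_add_cancel, zero_add,
      add_eq_zero_iff_eq_neg]
  refine ⟨fun h => ?_, fun ⟨σ, h₁, h₂⟩ => (split σ h₁).mpr h₂⟩
  suffices ∃ σ : Equiv.Perm (Fin 4), v (σ 0) = -v (σ 1) from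
    this.imp fun σ hσ => ⟨hσ, (split σ hσ).mp h⟩
  have h₃ : v 0 + v 1 + v 2 = -v 3 := by
    rwa [Fin.sum_univ_four, add_eq_zero_iff_eq_neg] at h
  have hunit : ((v 0).1 + (v 1).1 + (v 2).1) ^ 2 + ((v 0).2 + (v 1).2 + (v 2).2) ^ 2 = 1 := by
    simp only [← Prod.fst_add, ← Prod.snd_add, h₃, Prod.fst_neg, Prod.snd_neg, neg_sq, hv]
  rcases exists_eq_neg_of_add_add_unit (hv 0) (hv 1) (hv 2) hunit with h | h | h
  · exact ⟨1, h⟩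
  · exact ⟨Equiv.swap 0 1 * Equiv.swap 1 2, h⟩
  · exact ⟨Equiv.swap 1 2, h⟩
end

section
/- Let m ≥ 1 be an integer and k₁, k₂, k₃, k₄ ∈ ℤ/4mℤ, and set t_i := π k_i/(2m) ∈ 𝕋 for i ∈ [4] (well defined since 4m · π/(2m) = 0 in 𝕋). If there exists a subset A ⊆ ℤ/4mℤ such that k₁ + A, k₂ + A, k₃ + A, k₄ + A partition ℤ/4mℤ, then there exists a Borel subset C ⊆ 𝕋 such that t₁ + C, t₂ + C, t₃ + C, t₄ + C partition 𝕋. Conversely, if no such subset A of ℤ/4mℤ exists, then there is no Lebesgue-measurable subset C ⊆ 𝕋 such that t₁ + C, t₂ + C, t₃ + C, t₄ + C are pairwise disjoint and the complement of their union has measure zero. -/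
open MeasureTheory Real

/-- The translates of `A` by the entries of `k` are pairwise disjoint and cover the group. -/
def IsDivision {ι G : Type*} [Add G] (k : ι → G) (A : Set G) : Prop :=
  (Pairwise fun i j => Disjoint ((k i + ·) '' A) ((k j + ·) '' A)) ∧
    (⋃ i, (k i + ·) '' A) = Set.univ

theorem mem_add_left_image_iff {G : Type*} [AddGroup G] {g x : G} {A : Set G} :
    x ∈ (g + ·) '' A ↔ -g + x ∈ A := by
  simp [Set.image_add_left]

theorem map_neg_add_of_map_add {G H : Type*} [AddGroup G] [AddGroup H] {τ : G → H} {f : H → G}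
    (hf : ∀ a x, f (τ a + x) = a + f x) (a : G) (x : H) : f (-τ a + x) = -a + f x := by
  rw [eq_neg_add_iff_add_eq, ← hf, add_neg_cancel_left]

/-- Divisions pull back along equivariant maps. -/
theorem IsDivision.preimage {ι G H : Type*} [AddGroup G] [AddGroup H] {τ : G → H} {f : H → G}
    (hf : ∀ a x, f (τ a + x) = a + f x) {k : ι → G} {A : Set G} (hA : IsDivision k A) :
    IsDivision (fun i => τ (k i)) (f ⁻¹' A) := by
  have key (i : ι) : (τ (k i) + ·) '' (f ⁻¹' A) = f ⁻¹' ((k i + ·) '' A) := by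
    ext x
    simp only [Set.mem_preimage, mem_add_left_image_iff, map_neg_add_of_map_add hf]
  refine ⟨fun i j hij => ?_, ?_⟩
  · simpa only [key] using (hA.1 hij).preimage f
  · simp only [key, ← Set.preimage_iUnion, hA.2, Set.preimage_univ]

/-- If `G` acts on `H` by translations through a homomorphism, then a subset of `H` whose
translates are disjoint and cover some orbit restricts to a division of `G`. -/
theorem IsDivision.of_orbit {ι G H : Type*} [AddGroup G] [AddGroup H] (τ : G →+ H)
    {k : ι → G} {C : Set H}
    (hC : Pairwise fun i j => Disjoint ((τ (k i) + ·) '' C) ((τ (k j) + ·) '' C))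
    {x : H} (hx : ∀ a, τ a + x ∈ ⋃ i, (τ (k i) + ·) '' C) :
    IsDivision k {a | τ a + x ∈ C} := by
  have key (i : ι) :
      (k i + ·) '' {a | τ a + x ∈ C} = (fun a => τ a + x) ⁻¹' ((τ (k i) + ·) '' C) := by
    ext a
    simp only [Set.mem_preimage, mem_add_left_image_iff, Set.mem_ofPred_eq, map_add, map_neg,
      add_assoc]
  refine ⟨fun i j hij => ?_, ?_⟩
  · simpa only [key] using (hC hij).preimage _
  · simp only [key, ← Set.preimage_iUnion]
    exact Set.eq_univ_of_forall hx

/-- A conull subset of a group with an invariant measure contains an orbit of every countable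
group of translations. -/
theorem exists_forall_add_mem_of_conull {G H : Type*} [Countable G] [AddGroup H]
    [MeasurableSpace H] [MeasurableAdd H] (μ : Measure H) [μ.IsAddLeftInvariant] [NeZero μ]
    (τ : G → H) {U : Set H} (hU : μ Uᶜ = 0) : ∃ x, ∀ a, τ a + x ∈ U := by
  have h : ∀ᵐ x ∂μ, x ∈ U := hU
  have h' : ∀ᵐ x ∂μ, ∀ a, τ a + x ∈ U := ae_all_iff.2 fun a =>
    (measurePreserving_add_left μ (τ a)).quasiMeasurePreserving.ae h
  exact h'.exists

/-- The embedding of `ℤ/Nℤ` into the circle of circumference `p` as the multiples of `p / N`. -/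
noncomputable def zmodToAddCircle (p : ℝ) (N : ℕ) [NeZero N] : ZMod N →+ AddCircle p :=
  ZMod.lift N ⟨zmultiplesHom (AddCircle p) ((p / N : ℝ) : AddCircle p), by
    have hN : (N : ℝ) ≠ 0 := NeZero.ne _
    rw [zmultiplesHom_apply, natCast_zsmul, ← AddCircle.coe_nsmul, nsmul_eq_mul,
      mul_div_cancel₀ _ hN, AddCircle.coe_period]⟩

theorem zmodToAddCircle_apply (p : ℝ) (N : ℕ) [NeZero N] (a : ZMod N) :
    zmodToAddCircle p N a = ((p * a.val / N : ℝ) : AddCircle p) := by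
  obtain ⟨n, hn⟩ : ∃ n : ℕ, n = a.val := ⟨_, rfl⟩
  have ha : ((n : ℤ) : ZMod N) = a := by simp [hn]
  rw [← hn, ← ha, zmodToAddCircle, ZMod.lift_coe, zmultiplesHom_apply, natCast_zsmul,
    ← AddCircle.coe_nsmul, nsmul_eq_mul]
  congr 1
  ring

/-- The index modulo `N` of the arc containing a point, when the circle of circumference `p` is
cut into `N` half-open arcs of equal length. -/
noncomputable def arcIndex (p : ℝ) [Fact (0 < p)] (N : ℕ) (x : AddCircle p) : ZMod N :=
  (⌊(AddCircle.equivIco p 0 x : ℝ) * N / p⌋ : ℤ)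

theorem arcIndex_coe (p : ℝ) [hp : Fact (0 < p)] (N : ℕ) (r : ℝ) :
    arcIndex p N (r : AddCircle p) = (⌊r * N / p⌋ : ℤ) := by
  have hp0 : p ≠ 0 := hp.out.ne'
  have hz : r = (AddCircle.equivIco p 0 r : ℝ) + toIcoDiv hp.out 0 r * p := by
    rw [← zsmul_eq_mul]
    exact (toIcoMod_add_toIcoDiv_zsmul hp.out 0 r).symm
  have key : r * N / p = (AddCircle.equivIco p 0 r : ℝ) * N / p + (toIcoDiv hp.out 0 r * N : ℤ) := by
    conv_lhs => rw [hz]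
    push_cast
    field_simp
  rw [key, Int.floor_add_intCast, arcIndex]
  simp

theorem measurable_arcIndex (p : ℝ) [Fact (0 < p)] (N : ℕ) : Measurable (arcIndex p N) := by
  have h : Measurable fun x : AddCircle p => (AddCircle.equivIco p 0 x : ℝ) :=
    measurable_subtype_coe.comp (AddCircle.measurableEquivIco p 0).measurable
  exact (measurable_from_top (f := fun z : ℤ => (z : ZMod N))).comp
    ((h.mul_const _).div_const _).floor

theorem arcIndex_zmodToAddCircle_add (p : ℝ) [hp : Fact (0 < p)] (N : ℕ) [NeZero N] (a : ZMod N)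
    (x : AddCircle p) : arcIndex p N (zmodToAddCircle p N a + x) = a + arcIndex p N x := by
  have hp0 : p ≠ 0 := hp.out.ne'
  have hN : (N : ℝ) ≠ 0 := NeZero.ne _
  obtain ⟨r, rfl⟩ := QuotientAddGroup.mk_surjective x
  have key : (p * a.val / N + r) * N / p = r * N / p + a.val := by
    field_simp
    ring
  rw [zmodToAddCircle_apply, ← AddCircle.coe_add, arcIndex_coe, arcIndex_coe, key,
    Int.floor_add_natCast]
  simp [add_comm]

/-- Divisibility of `𝕋` by the four translations `tᵢ = π kᵢ/(2m)`, with `kᵢ ∈ ℤ/4mℤ`, reduces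
to the divisibility of the cyclic group `ℤ/4mℤ` by `k₁, k₂, k₃, k₄`: if `ℤ/4mℤ` is
`(k₁,…,k₄)`-divisible then `𝕋` is Borel `(t₁,…,t₄)`-divisible, and otherwise there is not
even a measurable `C ⊆ 𝕋` whose translates by `t₁,…,t₄` are pairwise disjoint and cover `𝕋`
up to a null set. -/
theorem circle_division_reduces_to_cyclic_group (m : ℕ) (hm : 1 ≤ m)
    (k : Fin 4 → ZMod (4 * m)) :
    ((∃ A : Set (ZMod (4 * m)),
        (Pairwise fun i j => Disjoint ((k i + ·) '' A) ((k j + ·) '' A)) ∧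
        (⋃ i, (k i + ·) '' A) = Set.univ) →
      ∃ C : Set (AddCircle (2 * π)), MeasurableSet C ∧
        (Pairwise fun i j => Disjoint
          ((((π * ((k i).val : ℝ) / (2 * m) : ℝ) : AddCircle (2 * π)) + ·) '' C)
          ((((π * ((k j).val : ℝ) / (2 * m) : ℝ) : AddCircle (2 * π)) + ·) '' C)) ∧
        (⋃ i : Fin 4,
          (((π * ((k i).val : ℝ) / (2 * m) : ℝ) : AddCircle (2 * π)) + ·) '' C) = Set.univ) ∧
    ((¬ ∃ A : Set (ZMod (4 * m)),
        (Pairwise fun i j => Disjoint ((k i + ·) '' A) ((k j + ·) '' A)) ∧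
        (⋃ i, (k i + ·) '' A) = Set.univ) →
      ¬ ∃ C : Set (AddCircle (2 * π)), NullMeasurableSet C volume ∧
        (Pairwise fun i j => Disjoint
          ((((π * ((k i).val : ℝ) / (2 * m) : ℝ) : AddCircle (2 * π)) + ·) '' C)
          ((((π * ((k j).val : ℝ) / (2 * m) : ℝ) : AddCircle (2 * π)) + ·) '' C)) ∧
        volume (Set.univ \ ⋃ i : Fin 4,
          (((π * ((k i).val : ℝ) / (2 * m) : ℝ) : AddCircle (2 * π)) + ·) '' C) = 0) := by
  have : NeZero (4 * m) := ⟨by omega⟩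
  have hτ (i : Fin 4) : ((π * ((k i).val : ℝ) / (2 * m) : ℝ) : AddCircle (2 * π)) =
      zmodToAddCircle (2 * π) (4 * m) (k i) := by
    rw [zmodToAddCircle_apply]
    congr 1
    have hm0 : (m : ℝ) ≠ 0 := by positivity
    push_cast
    field_simp
    ring
  simp only [hτ]
  refine ⟨?_, ?_⟩
  · rintro ⟨A, hA⟩
    exact ⟨arcIndex (2 * π) (4 * m) ⁻¹' A, measurable_arcIndex _ _ trivial,
      IsDivision.preimage (arcIndex_zmodToAddCircle_add _ _) hA⟩
  · rintro hA ⟨C, -, hC, hU⟩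
    rw [← Set.compl_eq_univ_sdiff] at hU
    obtain ⟨x, hx⟩ := exists_forall_add_mem_of_conull volume
      (zmodToAddCircle (2 * π) (4 * m)) hU
    exact hA ⟨_, IsDivision.of_orbit _ hC hx⟩
end

section
/- Let m ≥ 1 be odd and let k be an integer with gcd(k, m) = 1. In ℤ/4mℤ, consider the 4-tuple (k, k+m, m, 0) of residues. Then there exists a subset A ⊆ ℤ/4mℤ such that the translates k + A, (k+m) + A, m + A, and 0 + A partition ℤ/4mℤ if and only if k ≡ 2 (mod 4). -/
/-- If adding `k` toggles membership in `C`, then so does adding an odd multiple of `k`. -/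
theorem add_odd_nsmul_mem_iff {G : Type*} [AddCommMonoid G] {C : Set G} {k : G}
    (hC : ∀ x, x + k ∈ C ↔ x ∉ C) {n : ℕ} (hn : Odd n) (x : G) :
    x + n • k ∈ C ↔ x ∉ C := by
  obtain ⟨t, rfl⟩ := hn
  induction t with
  | zero => simpa using hC x
  | succ t ih =>
    have h : x + (2 * (t + 1) + 1) • k = x + (2 * t + 1) • k + k + k := by
      rw [show 2 * (t + 1) + 1 = 2 * t + 1 + 1 + 1 by ring, succ_nsmul, succ_nsmul]
      simp only [add_assoc]
    rw [h, hC, hC, not_not, ih]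

/-- If `k + A`, `k + m + A`, `m + A` and `A` partition a commutative group, then adding `k`
toggles membership in `A ∪ (m + A)`. -/
theorem add_mem_union_iff_of_partition {G : Type*} [AddCommGroup G] {k m : G} {A : Set G}
    (hd : Pairwise fun i j : Fin 4 => Disjoint
      ((![k, k + m, m, 0] i + ·) '' A) ((![k, k + m, m, 0] j + ·) '' A))
    (hu : (⋃ i : Fin 4, (![k, k + m, m, 0] i + ·) '' A) = Set.univ) (x : G) :
    x + k ∈ A ∪ (m + ·) '' A ↔ x ∉ A ∪ (m + ·) '' A := by
  constructor
  · rintro (h | ⟨a, ha, h⟩) (h' | ⟨b, hb, h'⟩)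
    · exact Set.disjoint_left.1 (hd (show (0 : Fin 4) ≠ 3 by decide))
        ⟨x, h', add_comm k x⟩ ⟨x + k, h, by simp⟩
    · exact Set.disjoint_left.1 (hd (show (1 : Fin 4) ≠ 3 by decide))
        ⟨b, hb, rfl⟩ ⟨x + k, h, by simp [← h']; abel⟩
    · exact Set.disjoint_left.1 (hd (show (0 : Fin 4) ≠ 2 by decide))
        ⟨x, h', add_comm k x⟩ ⟨a, ha, h⟩
    · exact Set.disjoint_left.1 (hd (show (1 : Fin 4) ≠ 2 by decide))
        ⟨b, hb, rfl⟩ ⟨a, ha, by simp at h h'; simp [h, ← h']; abel⟩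
  · intro h
    obtain ⟨i, a, ha, hi⟩ := Set.mem_iUnion.1 (hu ▸ Set.mem_univ (x + k))
    fin_cases i
    · refine absurd (Or.inl ?_) h
      have : a = x := by simpa [add_comm x k] using hi
      exact this ▸ ha
    · refine absurd (Or.inr ⟨a, ha, ?_⟩) h
      simpa [add_comm x k, add_assoc] using hi
    · exact Or.inr ⟨a, ha, hi⟩
    · have : a = x + k := by simpa using hi
      exact Or.inl (this ▸ ha)

/-- For odd `m` and `k` coprime to `m`, the cyclic group `ℤ/4mℤ` is divisible by the
four translations `k, k + m, m, 0` iff `k ≡ 2 (mod 4)`. -/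
theorem cyclic_group_division_iff (m : ℕ) (hm1 : 1 ≤ m) (hm : Odd m)
    (k : ℤ) (hk : Int.gcd k m = 1) :
    (∃ A : Set (ZMod (4 * m)),
      (Pairwise fun i j : Fin 4 => Disjoint
        ((![(k : ZMod (4 * m)), (k : ZMod (4 * m)) + (m : ZMod (4 * m)),
            (m : ZMod (4 * m)), 0] i + ·) '' A)
        ((![(k : ZMod (4 * m)), (k : ZMod (4 * m)) + (m : ZMod (4 * m)),
            (m : ZMod (4 * m)), 0] j + ·) '' A)) ∧
      (⋃ i : Fin 4,
        (![(k : ZMod (4 * m)), (k : ZMod (4 * m)) + (m : ZMod (4 * m)),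
            (m : ZMod (4 * m)), 0] i + ·) '' A) = Set.univ) ↔
    k % 4 = 2 := by
  have : NeZero (4 * m) := ⟨by omega⟩
  obtain ⟨s, hs⟩ := hm
  constructor
  · rintro ⟨A, hd, hu⟩
    have hC := add_mem_union_iff_of_partition hd hu
    rcases Int.emod_two_eq_zero_or_one k with hk2 | hk2
    · by_contra hk4
      have hzero : m • (k : ZMod (4 * m)) = 0 := by
        obtain ⟨q, rfl⟩ : (4 : ℤ) ∣ k := by omega
        have h := ZMod.natCast_self (4 * m)
        push_cast at h ⊢
        rw [nsmul_eq_mul]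
        linear_combination (q : ZMod (4 * m)) * h
      have h := add_odd_nsmul_mem_iff hC ⟨s, hs⟩ 0
      rw [hzero, add_zero] at h
      exact iff_not_self h
    · have hcop : IsCoprime k ((4 * m : ℕ) : ℤ) := by
        push_cast
        refine IsCoprime.mul_right ?_ (Int.isCoprime_iff_gcd_eq_one.2 hk)
        have h2 : IsCoprime k 2 := ⟨1, -(k / 2), by omega⟩
        exact (by norm_num : (2 : ℤ) ^ 2 = 4) ▸ h2.pow_right (n := 2)
      obtain ⟨u, v, huv⟩ := hcop
      set j : ℕ := ((m * u : ℤ) : ZMod (4 * m)).val with hj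
      have hjk : j • (k : ZMod (4 * m)) = m := by
        have h := congrArg (Int.cast : ℤ → ZMod (4 * m)) huv
        push_cast at h
        have h0 := ZMod.natCast_self (4 * m)
        push_cast at h0
        rw [nsmul_eq_mul, hj, ZMod.natCast_zmod_val]
        push_cast
        linear_combination (m : ZMod (4 * m)) * h - m * v * h0
      have hodd : Odd j := by
        have h : ((j * k - m : ℤ) : ZMod (4 * m)) = 0 := by
          rw [nsmul_eq_mul] at hjk
          push_cast
          rw [hjk, sub_self]
        rw [ZMod.intCast_zmod_eq_zero_iff_dvd] at h
        obtain ⟨c, hc⟩ := h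
        have hjko : Odd ((j : ℤ) * k) :=
          ⟨s + 2 * (m * c), by push_cast at hc; rw [hs] at hc ⊢; push_cast at hc ⊢; linarith⟩
        exact_mod_cast (Int.odd_mul.1 hjko).1
      obtain ⟨a, ha⟩ : A.Nonempty := by
        obtain ⟨_, a, ha, _⟩ := Set.mem_iUnion.1 (hu ▸ Set.mem_univ (0 : ZMod (4 * m)))
        exact ⟨a, ha⟩
      have h := add_odd_nsmul_mem_iff hC hodd a
      rw [hjk] at h
      exact absurd (Or.inl ha) (h.1 (Or.inr ⟨a, ha, add_comm _ _⟩))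
  · intro hk2
    let φ : ZMod (4 * m) →+* ZMod 4 := ZMod.castHom (dvd_mul_right 4 m) (ZMod 4)
    have hφk : φ k = 2 := by
      rw [map_intCast]
      exact (ZMod.intCast_eq_intCast_iff k 2 4).2 (by simpa [Int.ModEq] using hk2)
    have hφm : φ m = 1 ∨ φ m = 3 := by
      rw [map_natCast]
      have : m % 4 = 1 ∨ m % 4 = 3 := by omega
      exact this.imp (fun h => (ZMod.natCast_eq_natCast_iff m 1 4).2 h)
        (fun h => (ZMod.natCast_eq_natCast_iff m 3 4).2 h)
    have hmem : ∀ t x, x ∈ (t + ·) '' {a | φ a = 0} ↔ φ x = φ t := by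
      refine fun t x => ⟨?_, fun h => ⟨x - t, by simp [h], by simp⟩⟩
      rintro ⟨a, ha, rfl⟩
      simpa using ha
    refine ⟨{a | φ a = 0}, fun i j hij => Set.disjoint_left.2 fun x hi hj => hij ?_,
      Set.eq_univ_of_forall fun x => Set.mem_iUnion.2 ?_⟩
    · rw [hmem] at hi hj
      have h := hi.symm.trans hj
      clear hi hj hij
      rcases hφm with hφm | hφm <;> fin_cases i <;> fin_cases j <;>
        simp [hφk, hφm] at h ⊢ <;> revert h <;> decide
    · simp only [hmem, Fin.exists_fin_succ]
      generalize φ x = y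
      rcases hφm with hφm | hφm <;> simp [hφk, hφm] <;> revert y <;> decide
end
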